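/- arXiv:1808.05749 — 3 statements merged into one kernel-verified Lean document; each statement's English description precedes it below -/
import Mathlib

section
/- Let γ ≥ 2 be an even integer and let ξ be a real number with 0 < ξ < π/2. Write a_{A(j)} = (2πj + ξ)/(γ+1), b_{A(j)} = (2πj + π − ξ)/(γ+1), a_{B(j)} = (2πj + π + ξ)/(γ+1), b_{B(j)} = (2πj + 2π − ξ)/(γ+1). Then Σ_{j=0}^{(γ−2)/2} [ (sin(2 b_{A(j)}) − sin(2 a_{A(j)})) + (sin(2 b_{B(j)}) − sin(2 a_{B(j)})) ] + (sin(2 b_{A(γ/2)}) − sin(2 a_{A(γ/2)})) = 0. -/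
open Real

theorem sum_range_sin_equally_spaced_eq_zero {N : ℕ} (hN : 2 ≤ N) (θ : ℝ) :
    ∑ k ∈ Finset.range N, Real.sin (2 * k * (π / N) + θ) = 0 := by
  have hN' : (2 : ℝ) ≤ N := by exact_mod_cast hN
  have hNπ : (N : ℝ) * (π / N) = π := by field_simp
  have hsin : Real.sin (π / N) ≠ 0 := by
    refine (Real.sin_pos_of_pos_of_lt_pi (by positivity) ?_).ne'
    exact div_lt_self Real.pi_pos (by linarith)
  generalize π / (N : ℝ) = h at *
  have htel : ∀ n : ℕ, 2 * Real.sin h * ∑ k ∈ Finset.range n, Real.sin (2 * k * h + θ) =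
      Real.cos (θ - h) - Real.cos (2 * (n * h) + (θ - h)) := by
    intro n
    induction n with
    | zero => simp
    | succ n ih =>
      rw [Finset.sum_range_succ, mul_add, ih]
      have h₁ : 2 * (n * h) + (θ - h) = (2 * n * h + θ) - h := by ring
      have h₂ : 2 * ((n + 1 : ℕ) * h) + (θ - h) = (2 * n * h + θ) + h := by push_cast; ring
      rw [h₁, h₂, Real.cos_sub (2 * n * h + θ) h, Real.cos_add (2 * n * h + θ) h]
      ring
  have hfull := htel N
  rw [hNπ, add_comm (2 * π), Real.cos_add_two_pi, sub_self] at hfull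
  exact (mul_eq_zero.mp hfull).resolve_left (mul_ne_zero two_ne_zero hsin)

theorem sum_range_even_add_odd {M : Type*} [AddCommMonoid M] (f : ℕ → M) (m : ℕ) :
    ∑ j ∈ Finset.range m, (f (2 * j) + f (2 * j + 1)) = ∑ k ∈ Finset.range (2 * m), f k := by
  induction m with
  | zero => simp
  | succ m ih =>
    rw [Finset.sum_range_succ, ih, Nat.mul_succ, Finset.sum_range_succ, Finset.sum_range_succ,
      add_assoc]

/-- (T₂ = 0, even case.) For `γ ≥ 2` even and `0 < ξ < π/2`,
`∑_{j=0}^{(γ−2)/2} [(sin(2b_{A(j)}) − sin(2a_{A(j)})) + (sin(2b_{B(j)}) − sin(2a_{B(j)}))]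
  + (sin(2b_{A(γ/2)}) − sin(2a_{A(γ/2)})) = 0`,
where `a_{A(j)} = (2πj + ξ)/(γ+1)`, `b_{A(j)} = (2πj + π − ξ)/(γ+1)`,
`a_{B(j)} = (2πj + π + ξ)/(γ+1)`, `b_{B(j)} = (2πj + 2π − ξ)/(γ+1)`. -/
theorem T2_eq_zero (γ : ℕ) (hγeven : Even γ) (hγ : 2 ≤ γ) (ξ : ℝ) (hξ0 : 0 < ξ)
    (hξ : ξ < π / 2) :
    (∑ j ∈ Finset.range ((γ - 2) / 2 + 1),
      ((Real.sin (2 * ((2 * π * j + π - ξ) / ((γ : ℝ) + 1))) -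
          Real.sin (2 * ((2 * π * j + ξ) / ((γ : ℝ) + 1)))) +
        (Real.sin (2 * ((2 * π * j + 2 * π - ξ) / ((γ : ℝ) + 1))) -
          Real.sin (2 * ((2 * π * j + π + ξ) / ((γ : ℝ) + 1)))))) +
      (Real.sin (2 * ((2 * π * (γ / 2 : ℕ) + π - ξ) / ((γ : ℝ) + 1))) -
        Real.sin (2 * ((2 * π * (γ / 2 : ℕ) + ξ) / ((γ : ℝ) + 1)))) = 0 := by
  obtain ⟨m, rfl⟩ := even_iff_exists_two_mul.mp hγeven
  have hrange : (2 * m - 2) / 2 + 1 = m := by omega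
  have hhalf : 2 * m / 2 = m := by omega
  rw [hrange, hhalf]
  set N : ℝ := ((2 * m : ℕ) : ℝ) + 1 with hN
  let f : ℕ → ℝ := fun k =>
    Real.sin (2 * k * (π / N) + 2 * (π - ξ) / N) - Real.sin (2 * k * (π / N) + 2 * ξ / N)
  have hf : ∑ k ∈ Finset.range (2 * m + 1), f k = 0 := by
    have h := sum_range_sin_equally_spaced_eq_zero (N := 2 * m + 1) (by omega)
    rw [Nat.cast_succ, ← hN] at h
    rw [Finset.sum_sub_distrib, h, h, sub_zero]
  rw [Finset.sum_range_succ, ← sum_range_even_add_odd] at hf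
  rw [← hf]
  congr 1
  · refine Finset.sum_congr rfl fun j _ => ?_
    simp only [f]
    congr 3 <;> push_cast <;> ring
  · simp only [f]
    congr 2 <;> push_cast <;> ring
end

section
/- Let γ ≥ 1 be an odd integer and let ξ be a real number with 0 < ξ < π/2. Then (2/π) ∫_{I₁} sin²θ dθ = 1 − 2ξ/π. -/
open Real MeasureTheory

/-- The interval `A(j) = [(2πj + ξ)/(γ+1), (2πj + π − ξ)/(γ+1)]`. -/
noncomputable def Aint (γ : ℕ) (ξ : ℝ) (j : ℕ) : Set ℝ :=
  Set.Icc ((2 * π * j + ξ) / ((γ : ℝ) + 1)) ((2 * π * j + π - ξ) / ((γ : ℝ) + 1))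

/-- The interval `B(j) = [(2πj + π + ξ)/(γ+1), (2πj + 2π − ξ)/(γ+1)]`. -/
noncomputable def Bint (γ : ℕ) (ξ : ℝ) (j : ℕ) : Set ℝ :=
  Set.Icc ((2 * π * j + π + ξ) / ((γ : ℝ) + 1)) ((2 * π * j + 2 * π - ξ) / ((γ : ℝ) + 1))

/-- The sines of `N ≥ 2` equally spaced angles on the circle sum to zero. -/
theorem sum_sin_equally_spaced {N : ℕ} (hN : 2 ≤ N) (a : ℝ) :
    ∑ k ∈ Finset.range N, Real.sin (2 * π * k / N + a) = 0 := by
  have hN' : (2 : ℝ) ≤ N := by exact_mod_cast hN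
  have hpos : 0 < Real.sin (π / N) := by
    apply Real.sin_pos_of_pos_of_lt_pi (by positivity)
    exact div_lt_self pi_pos (by linarith)
  have step : ∀ k : ℕ, 2 * Real.sin (π / N) * Real.sin (2 * π * k / N + a) =
      Real.cos (2 * π * k / N + a - π / N) -
        Real.cos (2 * π * (k + 1 : ℕ) / N + a - π / N) := by
    intro k
    have h : 2 * π * (k + 1 : ℕ) / N + a - π / N = 2 * π * k / N + a + π / N := by
      push_cast
      field_simp
      ring
    rw [h, Real.cos_sub, Real.cos_add _ (π / N)]
    ring
  have hsum : 2 * Real.sin (π / N) * ∑ k ∈ Finset.range N, Real.sin (2 * π * k / N + a) = 0 := by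
    rw [Finset.mul_sum, Finset.sum_congr rfl fun k _ => step k,
      Finset.sum_range_sub' fun k : ℕ => Real.cos (2 * π * k / N + a - π / N)]
    have h : 2 * π * (N : ℝ) / N + a - π / N = 2 * π * (0 : ℕ) / N + a - π / N + 2 * π := by
      push_cast
      field_simp
      ring
    rw [h, Real.cos_add_two_pi, sub_self]
  exact (mul_eq_zero.mp hsum).resolve_left (by positivity)

theorem setIntegral_Icc_sin_sq {a b : ℝ} (hab : a ≤ b) :
    ∫ θ in Set.Icc a b, Real.sin θ ^ 2 =
      (b - a) / 2 - (Real.sin (2 * b) - Real.sin (2 * a)) / 4 := by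
  rw [integral_Icc_eq_integral_Ioc, ← intervalIntegral.integral_of_le hab, integral_sin_sq,
    Real.sin_two_mul, Real.sin_two_mul]
  ring

/-- Integral of `sin²` over `N` equally spaced intervals `[(πk + ξ)/N, (πk + π - ξ)/N]`. -/
theorem setIntegral_sin_sq_biUnion_Icc {N : ℕ} (hN : 2 ≤ N) {ξ : ℝ} (hξ0 : 0 < ξ)
    (hξ : ξ < π / 2) :
    ∫ θ in ⋃ k ∈ Finset.range N, Set.Icc ((π * k + ξ) / N) ((π * k + π - ξ) / N),
      Real.sin θ ^ 2 = (π - 2 * ξ) / 2 := by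
  have hN0 : (0 : ℝ) < N := by exact_mod_cast (by omega : 0 < N)
  have hlt : ∀ k l : ℕ, k < l → (π * k + π - ξ) / N < (π * l + ξ) / N := by
    intro k l hkl
    have hkl' : (k : ℝ) + 1 ≤ l := by exact_mod_cast hkl
    have := mul_le_mul_of_nonneg_left hkl' pi_pos.le
    apply div_lt_div_of_pos_right _ hN0
    linarith
  have hdisj : Pairwise fun k l : ℕ => Disjoint
      (Set.Icc ((π * k + ξ) / N) ((π * k + π - ξ) / N))
      (Set.Icc ((π * l + ξ) / N) ((π * l + π - ξ) / N)) := by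
    intro k l hkl
    rw [Set.disjoint_left]
    rintro x ⟨hx1, hx2⟩ ⟨hx3, hx4⟩
    rcases lt_or_gt_of_ne hkl with h | h
    · linarith [hlt k l h]
    · linarith [hlt l k h]
  rw [integral_biUnion_finset _ (fun _ _ => measurableSet_Icc) (hdisj.set_pairwise _)
    fun _ _ => (by fun_prop : Continuous fun θ : ℝ => Real.sin θ ^ 2).continuousOn.integrableOn_Icc]
  have hterm : ∀ k : ℕ, ∫ θ in Set.Icc ((π * k + ξ) / N) ((π * k + π - ξ) / N), Real.sin θ ^ 2 =
      (π - 2 * ξ) / (2 * N) - (Real.sin (2 * π * k / N + 2 * (π - ξ) / N) -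
        Real.sin (2 * π * k / N + 2 * ξ / N)) / 4 := by
    intro k
    rw [setIntegral_Icc_sin_sq (div_le_div_of_nonneg_right (by linarith) hN0.le)]
    ring_nf
  rw [Finset.sum_congr rfl fun k _ => hterm k, Finset.sum_sub_distrib, Finset.sum_const,
    ← Finset.sum_div, Finset.sum_sub_distrib, sum_sin_equally_spaced hN,
    sum_sin_equally_spaced hN, Finset.card_range, nsmul_eq_mul]
  field_simp
  ring

theorem biUnion_range_two_mul {α : Type*} (s : ℕ → Set α) (m : ℕ) :
    ⋃ k ∈ Finset.range (2 * m), s k =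
      ⋃ j ∈ Finset.range m, (s (2 * j) ∪ s (2 * j + 1)) := by
  induction m with
  | zero => simp
  | succ m ih =>
    rw [show 2 * (m + 1) = 2 * m + 1 + 1 by ring]
    simp only [Finset.range_add_one (n := m), Finset.range_add_one (n := 2 * m + 1),
      Finset.range_add_one (n := 2 * m), Finset.set_biUnion_insert, ih]
    ac_rfl

/-- For `γ ≥ 1` odd and `0 < ξ < π/2`, the Sato–Tate measure of
`I₁ = ⋃_{j=0}^{(γ−1)/2} (A(j) ∪ B(j))` is `(2/π) ∫_{I₁} sin²θ dθ = 1 − 2ξ/π`. -/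
theorem satoTate_measure_I1 (γ : ℕ) (hγodd : Odd γ) (hγ : 1 ≤ γ) (ξ : ℝ)
    (hξ0 : 0 < ξ) (hξ : ξ < π / 2) :
    2 / π *
        ∫ θ in (⋃ j ∈ Finset.range ((γ - 1) / 2 + 1), (Aint γ ξ j ∪ Bint γ ξ j)),
          Real.sin θ ^ 2
      = 1 - 2 * ξ / π := by
  obtain ⟨n, rfl⟩ := hγodd
  have hunion : (⋃ j ∈ Finset.range ((2 * n + 1 - 1) / 2 + 1),
      (Aint (2 * n + 1) ξ j ∪ Bint (2 * n + 1) ξ j)) =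
      ⋃ k ∈ Finset.range (2 * (n + 1)), Set.Icc ((π * k + ξ) / (2 * (n + 1) : ℕ))
        ((π * k + π - ξ) / (2 * (n + 1) : ℕ)) := by
    rw [biUnion_range_two_mul, show (2 * n + 1 - 1) / 2 + 1 = n + 1 by omega]
    refine Set.iUnion₂_congr fun j _ => ?_
    unfold Aint Bint
    push_cast
    congr 3 <;> ring
  rw [hunion, setIntegral_sin_sq_biUnion_Icc (by omega) hξ0 hξ]
  field_simp
end

section
/- Theorem (Bohr–Jessen). Fix a real number σ > 1/2. Then there exists a continuous function F : ℂ → ℝ with F ≥ 0 such that for every rectangle R = {z ∈ ℂ : x₁ ≤ Re z ≤ x₂, y₁ ≤ Im z ≤ y₂} (with x₁ ≤ x₂, y₁ ≤ y₂), the limit lim_{T→∞} (1/(2T)) · μ₁{ t ∈ [−T, T] : t ∈ Ω_σ and ℓ_σ(t) ∈ R } exists and equals ∫_R F(x+iy) dx dy / (2π). -/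
open MeasureTheory Filter

/-- `Ω_σ`: the set of `t ∈ ℝ` such that `ζ(u + it) ≠ 0` for all `u ∈ [σ, 2]`. -/
def OmegaZeta (σ : ℝ) : Set ℝ :=
  {t : ℝ | ∀ u ∈ Set.Icc σ 2, riemannZeta (u + t * Complex.I) ≠ 0}

/-- `ℓ_σ(t) = ∑_p ∑_{k≥1} p^{−k(2+it)}/k − ∫_σ^2 (ζ′/ζ)(u + it) du`, the value of
`log ζ(σ + it)` obtained by analytic continuation along the horizontal segment
from `2 + it` to `σ + it`. -/
noncomputable def logZetaLine (σ t : ℝ) : ℂ :=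
  (∑' p : Nat.Primes, ∑' k : ℕ,
      ((p : ℕ) : ℂ) ^ (-((k : ℂ) + 1) * (2 + t * Complex.I)) / ((k : ℂ) + 1)) -
    ∫ u in σ..2,
      deriv riemannZeta (u + t * Complex.I) / riemannZeta (u + t * Complex.I)

namespace BohrJessen

section

open scoped FourierTransform SchwartzMap ENNReal

theorem ae_eq_fourier_toLp {f : ℝ → ℂ} (hf : Integrable f) (hf2 : MemLp f 2) :
    (𝓕 (hf2.toLp f) : Lp ℂ 2 (volume : Measure ℝ)) =ᵐ[volume] 𝓕 f := by
  have hcont : Continuous (𝓕 f) :=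
    VectorFourier.fourierIntegral_continuous Real.continuous_fourierChar
    continuous_inner hf
  apply ae_eq_of_integral_contDiff_smul_eq
  · exact (Lp.memLp _).locallyIntegrable (by norm_num)
  · exact hcont.locallyIntegrable
  · intro g hg hgs
    have hgs' : HasCompactSupport (fun x => (g x : ℂ)) :=
      hgs.comp_left (g := fun x : ℝ => (x : ℂ)) (by simp)
    have hg' : ContDiff ℝ ((⊤ : ℕ∞) : WithTop ℕ∞) (fun x => (g x : ℂ)) :=
      Complex.ofRealCLM.contDiff.comp hg
    let G : 𝓢(ℝ, ℂ) := hgs'.toSchwartzMap hg'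
    have hG : ∀ x, G x = (g x : ℂ) := fun x => rfl
    have h1 := congrArg (fun D => D G)
      (Lp.fourier_toTemperedDistribution_eq (hf2.toLp f : Lp ℂ 2 (volume : Measure ℝ)))
    simp only [TemperedDistribution.fourier_apply, Lp.toTemperedDistribution_apply] at h1
    have h2 : ∫ x, g x • (𝓕 (hf2.toLp f) : Lp ℂ 2 (volume : Measure ℝ)) x
        = ∫ x, G x • (𝓕 (hf2.toLp f) : Lp ℂ 2 (volume : Measure ℝ)) x := by
      simp [hG]
    have h3 : ∫ x, g x • 𝓕 f x = ∫ x, G x • 𝓕 f x := by simp [hG]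
    rw [h2, h3, ← h1]
    have h4 : ∫ x, 𝓕 G x • (hf2.toLp f) x = ∫ x, 𝓕 G x • f x := by
      apply integral_congr_ae
      filter_upwards [hf2.coeFn_toLp] with x hx
      rw [hx]
    rw [h4]
    have h5 := VectorFourier.integral_fourierIntegral_smul_eq_flip (L := innerₗ ℝ) (μ := volume)
      (ν := volume) (e := Real.fourierChar) (f := fun x => G x) (g := f)
      Real.continuous_fourierChar continuous_inner G.integrable hf
    simp only [flip_innerₗ] at h5
    exact h5

theorem lintegral_enorm_sq_fourier {f : ℝ → ℂ} (hf : Integrable f) (hf2 : MemLp f 2) :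
    ∫⁻ ξ, ‖𝓕 f ξ‖ₑ ^ 2 = ∫⁻ x, ‖f x‖ₑ ^ 2 := by
  have h1 : eLpNorm (𝓕 f) 2 volume = eLpNorm f 2 volume := by
    rw [← eLpNorm_congr_ae (ae_eq_fourier_toLp hf hf2), ← eLpNorm_congr_ae hf2.coeFn_toLp,
      ← Lp.enorm_def, ← Lp.enorm_def, ← ofReal_norm, ← ofReal_norm, Lp.norm_fourier_eq]
  simp only [eLpNorm_eq_lintegral_rpow_enorm_toReal (p := 2) (by norm_num) (by norm_num)] at h1
  have := congrArg (fun x => x ^ (2 : ℝ)) h1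
  simp only [← ENNReal.rpow_mul] at this
  norm_num at this
  exact this

end

section

open scoped Finset

/-- The number of integers `1 < n ≤ x` coprime to `q`. -/
noncomputable def coprimeCount (q : ℕ) (x : ℝ) : ℕ := #{n ∈ Finset.Ioc 1 ⌊x⌋₊ | q.Coprime n}

/-- The error term in the count of the integers `1 < n ≤ x` coprime to `q`. -/
noncomputable def coprimeErr (q : ℕ) (x : ℝ) : ℝ :=
  coprimeCount q x - (q.totient / q : ℝ) * max (x - 1) 0

theorem totient_div_nonneg (q : ℕ) : (0 : ℝ) ≤ q.totient / q := by positivity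

theorem totient_div_le_one (q : ℕ) : (q.totient / q : ℝ) ≤ 1 :=
  div_le_one_of_le₀ (by exact_mod_cast Nat.totient_le q) (by positivity)

theorem coprimeCount_mono (q : ℕ) : Monotone (coprimeCount q) := by
  intro x y h
  apply Finset.card_le_card
  apply Finset.filter_subset_filter
  exact Finset.Ioc_subset_Ioc le_rfl (Nat.floor_mono h)

theorem measurable_coprimeErr (q : ℕ) : Measurable (coprimeErr q) := by
  unfold coprimeErr
  have : Measurable fun x => (coprimeCount q x : ℝ) :=
    (Nat.mono_cast.comp (coprimeCount_mono q)).measurable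
  fun_prop

theorem coprimeErr_of_le_one (q : ℕ) {x : ℝ} (hx : x ≤ 1) : coprimeErr q x = 0 := by
  have h : ⌊x⌋₊ ≤ 1 := by
    simpa using Nat.floor_mono hx
  have : coprimeCount q x = 0 := by
    simp [coprimeCount, Finset.Ioc_eq_empty_of_le h]
  rw [coprimeErr, this, max_eq_right (by linarith)]
  simp

theorem abs_card_coprime_sub_le (q n : ℕ) (hq : q ≠ 0) :
    |(#{m ∈ Finset.Ioc 0 n | q.Coprime m} : ℝ) - (q.totient / q : ℝ) * n| ≤ q := by
  set e : ℕ → ℝ := fun n => (#{m ∈ Finset.Ioc 0 n | q.Coprime m} : ℝ) - (q.totient / q : ℝ) * n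
    with he
  have hper : Function.Periodic e q := by
    intro n
    have h1 : Finset.Ioc 0 (n + q) = Finset.Ioc 0 n ∪ Finset.Ico (n + 1) (n + 1 + q) := by
      ext m
      simp only [Finset.mem_union, Finset.mem_Ioc, Finset.mem_Ico]
      omega
    have h2 : Disjoint (Finset.Ioc 0 n) (Finset.Ico (n + 1) (n + 1 + q)) := by
      rw [Finset.disjoint_left]
      intro m
      simp only [Finset.mem_Ioc, Finset.mem_Ico]
      omega
    have hq' : (q : ℝ) ≠ 0 := by exact_mod_cast hq
    simp only [he]
    rw [h1, Finset.filter_union, Finset.card_union_of_disjoint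
      (Finset.disjoint_filter_filter h2), Nat.filter_coprime_Ico_eq_totient]
    push_cast
    field_simp
    ring
  have h3 : e n = e (n % q) := (hper.map_mod_nat n).symm
  change |e n| ≤ q
  rw [h3]
  have h4 : (#{m ∈ Finset.Ioc 0 (n % q) | q.Coprime m} : ℝ) ≤ (n % q : ℕ) := by
    have := Finset.card_filter_le (Finset.Ioc 0 (n % q)) (fun m => q.Coprime m)
    rw [Nat.card_Ioc, Nat.sub_zero] at this
    exact_mod_cast this
  have h5 : ((n % q : ℕ) : ℝ) ≤ q := by exact_mod_cast (Nat.mod_lt _ (Nat.pos_of_ne_zero hq)).le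
  have h6 : (q.totient / q : ℝ) * (n % q : ℕ) ≤ (n % q : ℕ) :=
    mul_le_of_le_one_left (by positivity) (totient_div_le_one q)
  have h7 : 0 ≤ (q.totient / q : ℝ) * (n % q : ℕ) := by positivity
  have h8 : (0 : ℝ) ≤ #{m ∈ Finset.Ioc 0 (n % q) | q.Coprime m} := by positivity
  rw [abs_le]
  constructor <;> simp only [he] <;> linarith

theorem abs_coprimeErr_le (q : ℕ) (hq : q ≠ 0) (x : ℝ) : |coprimeErr q x| ≤ q + 3 := by
  rcases le_or_gt x 1 with hx | hx
  · rw [coprimeErr_of_le_one q hx]; simp; positivity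
  have hn : 1 ≤ ⌊x⌋₊ := Nat.one_le_floor_iff x |>.2 hx.le
  have h1 : Finset.Ioc 0 ⌊x⌋₊ = insert 1 (Finset.Ioc 1 ⌊x⌋₊) := by
    ext m
    simp only [Finset.mem_insert, Finset.mem_Ioc]
    omega
  have h2 : (#{m ∈ Finset.Ioc 0 ⌊x⌋₊ | q.Coprime m} : ℝ) = coprimeCount q x + 1 := by
    rw [h1, Finset.filter_insert, if_pos (Nat.coprime_one_right q), Finset.card_insert_of_notMem
      (by simp), coprimeCount]
    push_cast; rfl
  have h3 := abs_card_coprime_sub_le q ⌊x⌋₊ hq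
  rw [h2, abs_le] at h3
  have h4 := Nat.floor_le (by linarith : 0 ≤ x)
  have h5 := (Nat.lt_floor_add_one x).le
  rw [coprimeErr, max_eq_left (by linarith)]
  set κ := (q.totient / q : ℝ)
  have hk0 : 0 ≤ κ := totient_div_nonneg q
  have hk1 : κ ≤ 1 := totient_div_le_one q
  have h6 : κ * (x - ⌊x⌋₊) ≤ 1 := by nlinarith
  have h7 : 0 ≤ κ * (x - ⌊x⌋₊) := mul_nonneg hk0 (by linarith)
  rw [abs_le]
  constructor <;> nlinarith

theorem locallyIntegrableOn_coprimeErr (q : ℕ) (hq : q ≠ 0) :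
    LocallyIntegrable (fun x => (coprimeErr q x : ℂ)) := by
  refine (locallyIntegrable_const (q + 3 : ℝ)).mono ?_ ?_
  · exact (Complex.measurable_ofReal.comp (measurable_coprimeErr q)).aestronglyMeasurable
  · refine Eventually.of_forall fun x => ?_
    rw [Complex.norm_real, Real.norm_eq_abs, Real.norm_of_nonneg (by positivity)]
    exact abs_coprimeErr_le q hq x

theorem isBigO_coprimeErr_top (q : ℕ) (hq : q ≠ 0) :
    (fun x => (coprimeErr q x : ℂ)) =O[atTop] fun x : ℝ => x ^ (-(0 : ℝ)) := by
  refine Asymptotics.IsBigO.of_bound (q + 3 : ℝ) (Eventually.of_forall fun x => ?_)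
  rw [Complex.norm_real, Real.norm_eq_abs]
  simpa using abs_coprimeErr_le q hq x

theorem isBigO_coprimeErr_zero (q : ℕ) (b : ℝ) :
    (fun x => (coprimeErr q x : ℂ)) =O[nhdsWithin 0 (Set.Ioi 0)] fun x : ℝ => x ^ (-b) := by
  refine Asymptotics.IsBigO.of_bound 1 ?_
  filter_upwards [mem_nhdsWithin_of_mem_nhds (Iio_mem_nhds (zero_lt_one' ℝ))] with x hx
  rw [coprimeErr_of_le_one q (le_of_lt hx)]
  simp

theorem differentiableAt_mellin_coprimeErr (q : ℕ) (hq : q ≠ 0) {s : ℂ} (hs : s.re < 0) :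
    DifferentiableAt ℂ (mellin fun x => (coprimeErr q x : ℂ)) s :=
  mellin_differentiableAt_of_isBigO_rpow (b := s.re - 1)
    ((locallyIntegrableOn_coprimeErr q hq).locallyIntegrableOn _) (isBigO_coprimeErr_top q hq) hs
    (isBigO_coprimeErr_zero q _) (by linarith)

theorem mellinConvergent_coprimeErr (q : ℕ) (hq : q ≠ 0) {s : ℂ} (hs : s.re < 0) :
    MellinConvergent (fun x => (coprimeErr q x : ℂ)) s :=
  mellinConvergent_of_isBigO_rpow (b := s.re - 1)
    ((locallyIntegrableOn_coprimeErr q hq).locallyIntegrableOn _) (isBigO_coprimeErr_top q hq) hs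
    (isBigO_coprimeErr_zero q _) (by linarith)

/-- The analytic function `s ∫_0^∞ E_q(x) x^{-s-1} dx`, where `E_q` is `coprimeErr q`. -/
noncomputable def errFun (q : ℕ) (s : ℂ) : ℂ := s * mellin (fun x => (coprimeErr q x : ℂ)) (-s)

theorem differentiableAt_errFun (q : ℕ) (hq : q ≠ 0) {s : ℂ} (hs : 0 < s.re) :
    DifferentiableAt ℂ (errFun q) s := by
  have h := differentiableAt_mellin_coprimeErr q hq (s := -s) (by simpa using hs)
  have h' : DifferentiableAt ℂ (fun z => mellin (fun x => (coprimeErr q x : ℂ)) (-z)) s :=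
    h.comp s differentiableAt_id.neg
  exact differentiableAt_id.mul h'

theorem integral_sub_one_mul_cpow {s : ℂ} (hs : 1 < s.re) :
    IntegrableOn (fun t : ℝ => ((t : ℂ) - 1) * (t : ℂ) ^ (-(s + 1))) (Set.Ioi 1) ∧
    s * ∫ t in Set.Ioi (1 : ℝ), ((t : ℂ) - 1) * (t : ℂ) ^ (-(s + 1)) = 1 / (s - 1) := by
  have h1 : (-s).re < -1 := by simpa using hs
  have h2 : (-(s + 1)).re < -1 := by simp; linarith
  have i1 := integrableOn_Ioi_cpow_of_lt h1 one_pos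
  have i2 := integrableOn_Ioi_cpow_of_lt h2 one_pos
  have he : Set.EqOn (fun t : ℝ => (t : ℂ) ^ (-s) - (t : ℂ) ^ (-(s + 1)))
      (fun t : ℝ => ((t : ℂ) - 1) * (t : ℂ) ^ (-(s + 1))) (Set.Ioi 1) := by
    intro t ht
    have ht0 : (t : ℂ) ≠ 0 := by
      have : (1 : ℝ) < t := ht
      exact_mod_cast (by linarith : t ≠ 0)
    have : (t : ℂ) ^ (-s) = t * (t : ℂ) ^ (-(s + 1)) := by
      rw [show -s = 1 + -(s + 1) by ring, Complex.cpow_add _ _ ht0, Complex.cpow_one]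
    simp only [this]
    ring
  refine ⟨(i1.sub i2).congr_fun he measurableSet_Ioi, ?_⟩
  rw [← setIntegral_congr_fun measurableSet_Ioi he, integral_sub i1 i2,
    integral_Ioi_cpow_of_lt h1 one_pos, integral_Ioi_cpow_of_lt h2 one_pos]
  have h3 : s ≠ 0 := by rintro rfl; simp at hs; linarith
  have h4 : s - 1 ≠ 0 := by
    intro h
    rw [sub_eq_zero] at h
    simp [h] at hs
  have h5 : -s + 1 ≠ 0 := by
    intro h; apply h4; linear_combination -h
  simp only [Complex.ofReal_one, Complex.one_cpow]
  field_simp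
  simp
  ring_nf
  field_simp
  ring

theorem errFun_eq_of_one_lt_re (q : ℕ) [NeZero q] {s : ℂ} (hs : 1 < s.re) :
    errFun q s = DirichletCharacter.LFunctionTrivChar q s - 1
      - ((q.totient / q : ℝ) : ℂ) / (s - 1) := by
  have hq : q ≠ 0 := NeZero.ne q
  set f : ℕ → ℂ := fun n => if 1 < n ∧ q.Coprime n then 1 else 0 with hf
  have hfle : ∀ n, ‖f n‖ ≤ 1 := by
    intro n; simp only [hf]; split_ifs <;> simp
  have hS : LSeriesSummable f s :=
    LSeriesSummable_of_bounded_of_one_lt_re (m := 1) (fun n _ => hfle n) hs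
  have hO : (fun n ↦ ∑ k ∈ Finset.Icc 1 n, f k) =O[atTop] fun n ↦ (n : ℝ) ^ (1 : ℝ) := by
    refine Asymptotics.IsBigO.of_bound 1 (Eventually.of_forall fun n => ?_)
    refine (norm_sum_le_of_le _ fun k _ => hfle k).trans ?_
    simp
  have h1 := LSeries_eq_mul_integral f zero_le_one hs hS hO
  have h2 : LSeries f s = DirichletCharacter.LFunctionTrivChar q s - 1 := by
    rw [DirichletCharacter.LFunctionTrivChar, DirichletCharacter.LFunction_eq_LSeries _ hs]
    have hδ : LSeries LSeries.delta s = 1 := by rw [LSeries_delta]; rfl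
    have hS' : LSeriesSummable (fun n => (1 : DirichletCharacter ℂ q) n) s :=
      LSeriesSummable_of_bounded_of_one_lt_re (m := 1)
        (fun n _ => DirichletCharacter.norm_le_one _ _) hs
    have hSδ : LSeriesSummable LSeries.delta s :=
      LSeriesSummable_of_bounded_of_one_lt_re (m := 1)
        (fun n _ => by unfold LSeries.delta; split_ifs <;> simp) hs
    rw [show (LSeries (fun n => (1 : DirichletCharacter ℂ q) n) s - 1 : ℂ) =
      LSeries (fun n => (1 : DirichletCharacter ℂ q) n) s - LSeries LSeries.delta s by rw [hδ],
      ← LSeries_sub hS' hSδ]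
    apply LSeries_congr
    intro n hn
    simp only [hf, Pi.sub_apply, LSeries.delta]
    by_cases hc : q.Coprime n
    · have hu : IsUnit (n : ZMod q) := (ZMod.isUnit_iff_coprime n q).2 hc.symm
      rw [MulChar.one_apply hu]
      by_cases h1 : n = 1
      · simp [h1]
      · have : 1 < n := by omega
        simp [h1, this, hc]
    · have hu : ¬ IsUnit (n : ZMod q) := fun h => hc ((ZMod.isUnit_iff_coprime n q).1 h).symm
      rw [MulChar.map_nonunit _ hu]
      have : n ≠ 1 := by rintro rfl; simp at hc
      simp [hc, this]
  obtain ⟨i3, h3⟩ := integral_sub_one_mul_cpow hs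
  have hsum : ∀ t : ℝ, ∑ k ∈ Finset.Icc 1 ⌊t⌋₊, f k = (coprimeCount q t : ℂ) := by
    intro t
    simp only [hf]
    rw [Finset.sum_boole, coprimeCount]
    congr 2
    ext n
    simp only [Finset.mem_filter, Finset.mem_Icc, Finset.mem_Ioc]
    constructor
    · rintro ⟨⟨a, b⟩, c, d⟩; exact ⟨⟨c, b⟩, d⟩
    · rintro ⟨⟨a, b⟩, c⟩; exact ⟨⟨a.le, b⟩, a, c⟩
  simp only [hsum] at h1
  set κ : ℝ := (q.totient / q : ℝ)
  have hmel : mellin (fun x => (coprimeErr q x : ℂ)) (-s)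
      = ∫ t in Set.Ioi (1 : ℝ), (coprimeErr q t : ℂ) * (t : ℂ) ^ (-(s + 1)) := by
    rw [mellin, ← integral_indicator measurableSet_Ioi, ← integral_indicator measurableSet_Ioi]
    congr 1
    ext t
    simp only [Set.indicator, Set.mem_Ioi, smul_eq_mul]
    by_cases ht : 1 < t
    · rw [if_pos ht, if_pos (by linarith), mul_comm]
      ring_nf
    · rw [if_neg ht, coprimeErr_of_le_one q (not_lt.1 ht)]
      simp
  have hconv := mellinConvergent_coprimeErr q hq (s := -s) (by simp; linarith)
  have i1 : IntegrableOn (fun t : ℝ => (coprimeErr q t : ℂ) * (t : ℂ) ^ (-(s + 1)))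
      (Set.Ioi 1) := by
    refine (IntegrableOn.mono_set hconv (Set.Ioi_subset_Ioi zero_le_one)).congr_fun ?_
      measurableSet_Ioi
    intro t _
    simp only [smul_eq_mul]
    rw [mul_comm]
    ring_nf
  have hsplit : Set.EqOn (fun t : ℝ => (coprimeCount q t : ℂ) * (t : ℂ) ^ (-(s + 1)))
      (fun t : ℝ => (coprimeErr q t : ℂ) * (t : ℂ) ^ (-(s + 1))
        + κ * (((t : ℂ) - 1) * (t : ℂ) ^ (-(s + 1)))) (Set.Ioi 1) := by
    intro t ht
    have : (1 : ℝ) < t := ht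
    simp only [coprimeErr, max_eq_left (by linarith : 0 ≤ t - 1)]
    push_cast
    simp only [κ]
    push_cast
    ring
  rw [setIntegral_congr_fun measurableSet_Ioi hsplit, integral_add i1 (i3.const_mul _),
    integral_const_mul, mul_add, ← hmel, h2] at h1
  rw [errFun]
  linear_combination (-1 : ℂ) * h1 - κ * h3

/-- Analytic continuation of `errFun_eq_of_one_lt_re`. -/
theorem errFun_eq (q : ℕ) [NeZero q] {s : ℂ} (hs : 0 < s.re) (hs1 : s ≠ 1) :
    errFun q s = DirichletCharacter.LFunctionTrivChar q s - 1
      - ((q.totient / q : ℝ) : ℂ) / (s - 1) := by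
  have hq : q ≠ 0 := NeZero.ne q
  set U : Set ℂ := {z | 0 < z.re}
  have hU : IsOpen U := isOpen_lt continuous_const Complex.continuous_re
  have hUc : IsPreconnected U := (convex_halfSpace_re_gt 0).isPreconnected
  set κ : ℂ := ((q.totient / q : ℝ) : ℂ)
  set f : ℂ → ℂ := fun z => (z - 1) * errFun q z
  set g : ℂ → ℂ := fun z => DirichletCharacter.LFunctionTrivChar₁ q z - (z - 1) - κ
  have hf : AnalyticOnNhd ℂ f U := by
    apply DifferentiableOn.analyticOnNhd _ hU
    intro z hz
    exact ((differentiableAt_id.sub_const 1).mul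
      (differentiableAt_errFun q hq hz)).differentiableWithinAt
  have hg : AnalyticOnNhd ℂ g U := by
    apply DifferentiableOn.analyticOnNhd _ hU
    intro z hz
    exact (((DirichletCharacter.differentiable_LFunctionTrivChar₁ q z).sub
      (differentiableAt_id.sub_const 1)).sub_const κ).differentiableWithinAt
  have hL : ∀ z : ℂ, z ≠ 1 → DirichletCharacter.LFunctionTrivChar₁ q z
      = (z - 1) * DirichletCharacter.LFunctionTrivChar q z := fun z hz => by
    simp [DirichletCharacter.LFunctionTrivChar₁, Function.update_of_ne hz]
  have h2 : (2 : ℂ) ∈ U := by simp [U]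
  have heq : f =ᶠ[nhds 2] g := by
    have : {z : ℂ | 1 < z.re} ∈ nhds (2 : ℂ) :=
      (isOpen_lt continuous_const Complex.continuous_re).mem_nhds (by simp)
    filter_upwards [this] with z hz
    have hz1 : z ≠ 1 := by rintro rfl; simp at hz
    have hz1' : z - 1 ≠ 0 := sub_ne_zero.2 hz1
    simp only [f, g]
    rw [errFun_eq_of_one_lt_re q hz, hL z hz1]
    field_simp
    ring
  have := hf.eqOn_of_preconnected_of_eventuallyEq hg hUc h2 heq hs
  simp only [f, g] at this
  rw [hL s hs1] at this
  have hs1' : s - 1 ≠ 0 := sub_ne_zero.2 hs1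
  have h : (s - 1) * errFun q s = (s - 1) * (DirichletCharacter.LFunctionTrivChar q s - 1
      - κ / (s - 1)) := by
    rw [this]; field_simp
  exact mul_left_cancel₀ hs1' h

end

section

open scoped Finset FourierTransform ENNReal

/-- The increment of `coprimeErr q` between `x` and `e^δ x`. -/
noncomputable def incrErr (q : ℕ) (δ x : ℝ) : ℝ := coprimeErr q (Real.exp δ * x) - coprimeErr q x

theorem measurable_incrErr (q : ℕ) (δ : ℝ) : Measurable (incrErr q δ) :=
  ((measurable_coprimeErr q).comp (measurable_const_mul _)).sub (measurable_coprimeErr q)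

theorem abs_incrErr_le (q : ℕ) (hq : q ≠ 0) (δ x : ℝ) : |incrErr q δ x| ≤ 2 * (q + 3) := by
  have h1 := abs_coprimeErr_le q hq (Real.exp δ * x)
  have h2 := abs_coprimeErr_le q hq x
  have h3 := abs_sub (coprimeErr q (Real.exp δ * x)) (coprimeErr q x)
  unfold incrErr
  linarith

theorem incrErr_eq_zero (q : ℕ) {δ w : ℝ} (hδ : 0 ≤ δ) (hw : δ ≤ w) :
    incrErr q δ (Real.exp (-w)) = 0 := by
  rw [incrErr, coprimeErr_of_le_one, coprimeErr_of_le_one, sub_zero]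
  · rw [Real.exp_le_one_iff]; linarith
  · rw [← Real.exp_add, Real.exp_le_one_iff]; linarith

theorem abs_exp_mul_incrErr_le (q : ℕ) (hq : q ≠ 0) {δ : ℝ} (hδ : 0 ≤ δ) (u w : ℝ) :
    |Real.exp (u * w) * incrErr q δ (Real.exp (-w))|
      ≤ (Set.Iic δ).indicator (fun w => 2 * (q + 3) * Real.exp (u * w)) w := by
  by_cases h : w ≤ δ
  · rw [Set.indicator_of_mem (by exact h), abs_mul, abs_of_pos (Real.exp_pos _), mul_comm]
    exact mul_le_mul_of_nonneg_right (abs_incrErr_le q hq _ _) (Real.exp_pos _).le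
  · rw [Set.indicator_of_notMem (by exact h), incrErr_eq_zero q hδ (not_le.1 h).le]
    simp

/-- The increment `incrErr q δ` in logarithmic coordinates, with weight `e^{uw}`. -/
noncomputable def logIncr (q : ℕ) (δ u w : ℝ) : ℂ :=
  ((Real.exp (u * w) * incrErr q δ (Real.exp (-w)) : ℝ) : ℂ)

theorem measurable_logIncr (q : ℕ) (δ u : ℝ) : Measurable (logIncr q δ u) := by
  unfold logIncr
  have := (measurable_incrErr q δ).comp (Real.measurable_exp.comp measurable_neg)
  refine Complex.measurable_ofReal.comp (Measurable.mul (by fun_prop) this)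

theorem integrable_logIncr (q : ℕ) (hq : q ≠ 0) {δ u : ℝ} (hδ : 0 ≤ δ) (hu : 0 < u) :
    Integrable (logIncr q δ u) := by
  have h : Integrable ((Set.Iic δ).indicator fun w => 2 * (q + 3) * Real.exp (u * w)) :=
    (integrable_indicator_iff measurableSet_Iic).2 ((integrableOn_exp_mul_Iic hu δ).const_mul _)
  refine h.mono' (measurable_logIncr q δ u).aestronglyMeasurable (Eventually.of_forall fun w => ?_)
  rw [logIncr, Complex.norm_real, Real.norm_eq_abs]
  exact abs_exp_mul_incrErr_le q hq hδ u w

theorem memLp_logIncr (q : ℕ) (hq : q ≠ 0) {δ u : ℝ} (hδ : 0 ≤ δ) (hu : 0 < u) :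
    MemLp (logIncr q δ u) 2 := by
  rw [memLp_two_iff_integrable_sq_norm (measurable_logIncr q δ u).aestronglyMeasurable]
  have h : Integrable ((Set.Iic δ).indicator fun w => (2 * (q + 3)) ^ 2 * Real.exp (2 * u * w)) :=
    (integrable_indicator_iff measurableSet_Iic).2
      ((integrableOn_exp_mul_Iic (by positivity) δ).const_mul _)
  refine h.mono' ((measurable_logIncr q δ u).norm.pow_const 2).aestronglyMeasurable
    (Eventually.of_forall fun w => ?_)
  rw [logIncr, Complex.norm_real, Real.norm_eq_abs, Real.norm_eq_abs, abs_pow, abs_abs]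
  refine (pow_le_pow_left₀ (abs_nonneg _) (abs_exp_mul_incrErr_le q hq hδ u w) 2).trans ?_
  by_cases h : w ≤ δ
  · rw [Set.indicator_of_mem (by exact h), Set.indicator_of_mem (by exact h), mul_pow,
      ← Real.exp_nat_mul]
    apply le_of_eq
    push_cast
    ring_nf
  · rw [Set.indicator_of_notMem (by exact h), Set.indicator_of_notMem (by exact h)]
    simp

theorem fourier_logIncr (q : ℕ) (hq : q ≠ 0) {δ : ℝ} {s : ℂ} (hs : 0 < s.re) :
    𝓕 (logIncr q δ s.re) (-s.im / (2 * Real.pi))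
      = (Complex.exp (s * δ) - 1) * (errFun q s / s) := by
  have hs0 : s ≠ 0 := by rintro rfl; simp at hs
  have hc := mellinConvergent_coprimeErr q hq (s := -s) (by simpa using hs)
  have hc' : MellinConvergent (fun x => (coprimeErr q (Real.exp δ * x) : ℂ)) (-s) :=
    (MellinConvergent.comp_mul_left (f := fun x => (coprimeErr q x : ℂ)) (Real.exp_pos δ)).2 hc
  have h1 := (hasMellin_sub hc' hc).2
  rw [mellin_comp_mul_left (fun x => (coprimeErr q x : ℂ)) _ (Real.exp_pos δ), neg_neg,
    mellin_eq_fourier] at h1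
  have h2 : ((Real.exp δ : ℝ) : ℂ) ^ s = Complex.exp (s * δ) := by
    rw [Complex.cpow_def_of_ne_zero (by exact_mod_cast (Real.exp_pos δ).ne'),
      ← Complex.ofReal_log (Real.exp_pos δ).le, Real.log_exp, mul_comm]
  rw [h2, smul_eq_mul] at h1
  have h3 : errFun q s / s = mellin (fun x => (coprimeErr q x : ℂ)) (-s) := by
    rw [errFun]; field_simp
  rw [h3, sub_mul, one_mul, ← h1]
  simp only [Complex.neg_im, Complex.neg_re, neg_neg]
  have h4 : logIncr q δ s.re = fun w => Real.exp (s.re * w) •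
      ((coprimeErr q (Real.exp δ * Real.exp (-w)) : ℂ) - coprimeErr q (Real.exp (-w))) := by
    ext w
    simp [logIncr, incrErr]
  rw [h4]

theorem lintegral_comp_mul_left_eq (g : ℝ → ℝ≥0∞) (hg : Measurable g) {a : ℝ} (ha : a ≠ 0) :
    ∫⁻ x, g (a * x) = ENNReal.ofReal |a⁻¹| * ∫⁻ x, g x := by
  rw [← lintegral_map hg (measurable_const_mul a), Real.map_volume_mul_left ha,
    lintegral_smul_measure, smul_eq_mul]

theorem half_norm_le_norm_exp_sub_one {z : ℂ} (hz : ‖z‖ ≤ 1 / 2) :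
    ‖z‖ / 2 ≤ ‖Complex.exp z - 1‖ := by
  have h1 := Complex.norm_exp_sub_one_sub_id_le (by linarith : ‖z‖ ≤ 1)
  have h2 := norm_sub_norm_le z (-(Complex.exp z - 1 - z))
  rw [norm_neg] at h2
  have h3 : z - -(Complex.exp z - 1 - z) = Complex.exp z - 1 := by ring
  rw [h3] at h2
  nlinarith [norm_nonneg z]

theorem lintegral_errFun_le (q : ℕ) (hq : q ≠ 0) {u T : ℝ} (hu : 0 < u) (hT : 0 < T)
    (huT : u ≤ T) :
    ∫⁻ t in Set.Icc (-T) T, ‖errFun q (u + t * Complex.I)‖ₑ ^ 2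
      ≤ ENNReal.ofReal (128 * Real.pi * T ^ 2)
        * ∫⁻ w, ‖logIncr q (1 / (4 * T)) u w‖ₑ ^ 2 := by
  set δ : ℝ := 1 / (4 * T) with hδ
  have hδ0 : 0 < δ := by positivity
  have hmeas : Measurable fun ξ => ‖𝓕 (logIncr q δ u) ξ‖ₑ ^ 2 := by
    have : Continuous (𝓕 (logIncr q δ u)) :=
      VectorFourier.fourierIntegral_continuous Real.continuous_fourierChar continuous_inner
        (integrable_logIncr q hq hδ0.le hu)
    exact (this.measurable.enorm).pow_const 2
  rw [← lintegral_enorm_sq_fourier (integrable_logIncr q hq hδ0.le hu)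
    (memLp_logIncr q hq hδ0.le hu)]
  have hpi := Real.pi_pos
  have h1 := lintegral_comp_mul_left_eq _ hmeas (a := -(2 * Real.pi)⁻¹) (by simp)
  have h2 : |(-(2 * Real.pi)⁻¹)⁻¹| = 2 * Real.pi := by
    rw [inv_neg, inv_inv, abs_neg, abs_of_pos (by positivity)]
  rw [h2] at h1
  have h3 : ENNReal.ofReal (128 * Real.pi * T ^ 2)
      = ENNReal.ofReal (64 * T ^ 2) * ENNReal.ofReal (2 * Real.pi) := by
    rw [← ENNReal.ofReal_mul (by positivity)]; ring_nf
  rw [h3, mul_assoc, ← h1, ← lintegral_const_mul' _ _ ENNReal.ofReal_ne_top]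
  refine (setLIntegral_mono_ae' measurableSet_Icc (Eventually.of_forall fun t ht => ?_)).trans
    (setLIntegral_le_lintegral _ _)
  set s : ℂ := u + t * Complex.I with hs
  have hre : s.re = u := by simp [hs]
  have him : s.im = t := by simp [hs]
  have h4 := fourier_logIncr q hq (δ := δ) (s := s) (by rw [hre]; exact hu)
  rw [hre, him] at h4
  have h5 : -(2 * Real.pi)⁻¹ * t = -t / (2 * Real.pi) := by ring
  rw [h5, h4]
  have hsn : 0 < ‖s‖ := by
    rw [norm_pos_iff]; intro h; rw [h] at hre; simp at hre; linarith
  have h6 : ‖s‖ ≤ 2 * T := by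
    refine (Complex.norm_le_abs_re_add_abs_im s).trans ?_
    rw [hre, him, abs_of_pos hu]
    have := abs_le.2 ht
    linarith
  have h7 : ‖s * δ‖ = ‖s‖ * δ := by
    rw [norm_mul, Complex.norm_real, Real.norm_eq_abs, abs_of_pos hδ0]
  have h8 : ‖s‖ * δ ≤ 1 / 2 := by
    calc ‖s‖ * δ ≤ 2 * T * δ := by gcongr
      _ = 1 / 2 := by rw [hδ]; field_simp; norm_num
  have h9 := half_norm_le_norm_exp_sub_one (z := s * δ) (by rw [h7]; exact h8)
  rw [h7] at h9
  have h10 : ‖errFun q s‖ ^ 2 ≤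
      64 * T ^ 2 * ‖(Complex.exp (s * δ) - 1) * (errFun q s / s)‖ ^ 2 := by
    have h11 : δ / 2 * ‖errFun q s‖ ≤ ‖(Complex.exp (s * δ) - 1) * (errFun q s / s)‖ := by
      rw [norm_mul, norm_div]
      calc δ / 2 * ‖errFun q s‖ = ‖s‖ * δ / 2 * (‖errFun q s‖ / ‖s‖) := by field_simp
        _ ≤ _ := by gcongr
    have h12 := pow_le_pow_left₀ (by positivity) h11 2
    calc ‖errFun q s‖ ^ 2 = 64 * T ^ 2 * (δ / 2 * ‖errFun q s‖) ^ 2 := by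
          rw [hδ]; field_simp; ring
      _ ≤ _ := by gcongr
  have h13 : ∀ z : ℂ, ‖z‖ₑ ^ 2 = ENNReal.ofReal (‖z‖ ^ 2) := fun z => by
    rw [ENNReal.ofReal_pow (norm_nonneg _), ofReal_norm]
  rw [h13, h13, ← ENNReal.ofReal_mul (by positivity)]
  exact ENNReal.ofReal_le_ofReal h10

end

section

open scoped Finset FourierTransform ENNReal

theorem exists_coprime_of_coprimeCount_sub {q : ℕ} {x y : ℝ} (hx : 0 ≤ x) (hxy : x ≤ y)
    (hy : y < x + 1) :
    coprimeCount q y = coprimeCount q x ∨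
      (coprimeCount q y = coprimeCount q x + 1 ∧
        ∃ n : ℕ, 1 < n ∧ q.Coprime n ∧ x < n ∧ (n : ℝ) ≤ y) := by
  set A : Finset ℕ := {n ∈ Finset.Ioc 1 ⌊x⌋₊ | q.Coprime n} with hA
  set B : Finset ℕ := {n ∈ Finset.Ioc 1 ⌊y⌋₊ | q.Coprime n} with hB
  have hAB : A ⊆ B :=
    Finset.filter_subset_filter _ (Finset.Ioc_subset_Ioc le_rfl (Nat.floor_mono hxy))
  have hmem : ∀ n ∈ B \ A, 1 < n ∧ q.Coprime n ∧ x < n ∧ (n : ℝ) ≤ y := by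
    intro n hn
    simp only [hA, hB, Finset.mem_sdiff, Finset.mem_filter, Finset.mem_Ioc, not_and] at hn
    obtain ⟨⟨⟨h1, h2⟩, h3⟩, h4⟩ := hn
    refine ⟨h1, h3, ?_, (Nat.le_floor_iff (hx.trans hxy)).1 h2⟩
    by_contra h5
    exact h4 ⟨h1, (Nat.le_floor_iff hx).2 (not_lt.1 h5)⟩ h3
  have hcard : #(B \ A) ≤ 1 := by
    rw [Finset.card_le_one]
    intro m hm n hn
    obtain ⟨-, -, h1, h2⟩ := hmem m hm
    obtain ⟨-, -, h3, h4⟩ := hmem n hn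
    have h5 : (m : ℝ) < n + 1 := by linarith
    have h6 : (n : ℝ) < m + 1 := by linarith
    have h5' : m < n + 1 := by exact_mod_cast h5
    have h6' : n < m + 1 := by exact_mod_cast h6
    omega
  have hsub : #(B \ A) + #A = #B := Finset.card_sdiff_add_card_eq_card hAB
  have e1 : coprimeCount q x = #A := rfl
  have e2 : coprimeCount q y = #B := rfl
  rw [e1, e2]
  rcases Nat.eq_zero_or_pos #(B \ A) with h | h
  · left; omega
  · right
    obtain ⟨n, hn⟩ := Finset.card_pos.1 h
    exact ⟨by omega, n, hmem n hn⟩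

theorem sq_incrErr_le (q : ℕ) (hq : q ≠ 0) {δ x a : ℝ} (hδ : 0 < δ) (hδ1 : δ ≤ 1) (hx : 0 < x)
    (ha0 : 0 ≤ a) (ha : a ≤ 2) :
    ENNReal.ofReal (incrErr q δ x ^ 2) ≤
      2 * (∑' n : ℕ, if 1 < n ∧ q.Coprime n then
        (Set.Ico (Real.exp (-δ) * n) n).indicator (fun _ => (1 : ℝ≥0∞)) x else 0)
      + ENNReal.ofReal (4 * (q + 3) ^ 2 * (2 * δ * x) ^ a) := by
  have hx2 : 0 < 2 * δ * x := by positivity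
  have hpow : 0 ≤ (2 * δ * x) ^ a := by positivity
  have hq3 : (9 : ℝ) ≤ (q + 3) ^ 2 := by nlinarith [(Nat.cast_nonneg q : (0 : ℝ) ≤ q)]
  have hexp : Real.exp δ - 1 ≤ 2 * δ := by
    have := Real.abs_exp_sub_one_le (x := δ) (by rw [abs_of_pos hδ]; exact hδ1)
    rw [abs_of_pos hδ] at this
    exact (le_abs_self _).trans this
  have hexp1 : 1 ≤ Real.exp δ := Real.one_le_exp hδ.le
  rcases le_or_gt 1 (2 * δ * x) with h | h
  · refine le_add_left (ENNReal.ofReal_le_ofReal ?_)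
    have h1 := abs_incrErr_le q hq δ x
    have h2 : incrErr q δ x ^ 2 ≤ (2 * (q + 3)) ^ 2 := by
      rw [← sq_abs]; exact pow_le_pow_left₀ (abs_nonneg _) h1 2
    have h3 : 1 ≤ (2 * δ * x) ^ a := Real.one_le_rpow h ha0
    nlinarith
  · have hxc : x ≤ Real.exp δ * x := le_mul_of_one_le_left hx.le hexp1
    set m := max (Real.exp δ * x - 1) 0 - max (x - 1) 0 with hm
    have hm0 : 0 ≤ m := sub_nonneg.2 (max_le_max (by linarith) le_rfl)
    have hm1 : m ≤ 2 * δ * x := by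
      have h1 : Real.exp δ * x - x ≤ 2 * δ * x := by nlinarith
      have := max_sub_max_le_max (Real.exp δ * x - 1) 0 (x - 1) 0
      refine this.trans (max_le (by linarith) (by linarith))
    have hk0 := totient_div_nonneg q
    have hk1 := totient_div_le_one q
    have hD : incrErr q δ x = ((coprimeCount q (Real.exp δ * x) : ℝ) - coprimeCount q x)
        - (q.totient / q : ℝ) * m := by
      simp only [incrErr, coprimeErr, hm]; ring
    have hkm : ((q.totient / q : ℝ) * m) ^ 2 ≤ (2 * δ * x) ^ a := by
      have h1 : (q.totient / q : ℝ) * m ≤ 2 * δ * x := by nlinarith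
      have h2 : 0 ≤ (q.totient / q : ℝ) * m := by positivity
      calc ((q.totient / q : ℝ) * m) ^ 2 ≤ (2 * δ * x) ^ 2 := pow_le_pow_left₀ h2 h1 2
        _ = (2 * δ * x) ^ (2 : ℝ) := by norm_cast
        _ ≤ (2 * δ * x) ^ a := Real.rpow_le_rpow_of_exponent_ge hx2 h.le ha
    rcases exists_coprime_of_coprimeCount_sub (q := q) hx.le hxc (by nlinarith) with
      h1 | ⟨h1, n, hn1, hn2, hn3, hn4⟩
    · refine le_add_left (ENNReal.ofReal_le_ofReal ?_)
      rw [hD, h1, sub_self, zero_sub, neg_sq]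
      nlinarith
    · have h2 : (1 : ℝ≥0∞) ≤ ∑' n : ℕ, if 1 < n ∧ q.Coprime n then
          (Set.Ico (Real.exp (-δ) * n) n).indicator (fun _ => (1 : ℝ≥0∞)) x else 0 := by
        refine le_trans ?_ (ENNReal.le_tsum n)
        rw [if_pos ⟨hn1, hn2⟩, Set.indicator_of_mem]
        refine ⟨?_, hn3⟩
        rw [Real.exp_neg, inv_mul_le_iff₀ (Real.exp_pos _)]
        exact hn4
      calc ENNReal.ofReal (incrErr q δ x ^ 2)
          ≤ ENNReal.ofReal (2 + 4 * (q + 3) ^ 2 * (2 * δ * x) ^ a) := by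
            apply ENNReal.ofReal_le_ofReal
            rw [hD, h1]
            push_cast
            nlinarith [sq_nonneg (1 + (q.totient / q : ℝ) * m)]
        _ = 2 * 1 + ENNReal.ofReal (4 * (q + 3) ^ 2 * (2 * δ * x) ^ a) := by
            rw [ENNReal.ofReal_add (by norm_num) (by positivity)]; simp
        _ ≤ _ := by gcongr

/-- The tail `∑ n^{-2σ}` over the integers `n > 1` coprime to `q`. -/
noncomputable def coprimeTail (q : ℕ) (σ : ℝ) : ℝ≥0∞ :=
  ∑' n : ℕ, if 1 < n ∧ q.Coprime n then ENNReal.ofReal ((n : ℝ) ^ (-(2 * σ))) else 0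

theorem lintegral_exp_indicator_le {δ u σ : ℝ} (hδ : 0 < δ) (hσu : σ ≤ u) (hu : 0 ≤ u)
    (huδ : u * δ ≤ 1 / 2) {n : ℕ} (hn : 1 < n) :
    ∫⁻ w, ENNReal.ofReal (Real.exp (u * w) ^ 2) *
      (Set.Ico (Real.exp (-δ) * n) (n : ℝ)).indicator (fun _ => (1 : ℝ≥0∞)) (Real.exp (-w))
      ≤ ENNReal.ofReal (3 * δ) * ENNReal.ofReal ((n : ℝ) ^ (-(2 * σ))) := by
  have hn1 : (1 : ℝ) < n := by exact_mod_cast hn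
  have hn0 : (0 : ℝ) < n := by linarith
  set b := Real.log n
  have hb : Real.exp b = n := Real.exp_log hn0
  calc _ ≤ ∫⁻ w, (Set.Ioc (-b) (δ - b)).indicator
        (fun _ => ENNReal.ofReal (3 * (n : ℝ) ^ (-(2 * σ)))) w := by
        apply lintegral_mono
        intro w
        dsimp only
        by_cases h : Real.exp (-w) ∈ Set.Ico (Real.exp (-δ) * n) (n : ℝ)
        · have h1 : -w < b := by rw [← Real.exp_lt_exp, hb]; exact h.2
          have h2 : -δ + b ≤ -w := by
            rw [← Real.exp_le_exp, Real.exp_add, hb]; exact h.1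
          rw [Set.indicator_of_mem h, Set.indicator_of_mem
            (show w ∈ Set.Ioc (-b) (δ - b) from ⟨by linarith, by linarith⟩), mul_one]
          apply ENNReal.ofReal_le_ofReal
          have h3 : (n : ℝ) ^ (-(2 * u)) ≤ (n : ℝ) ^ (-(2 * σ)) :=
            Real.rpow_le_rpow_of_exponent_le hn1.le (by linarith)
          have h4 : Real.exp (u * w) ^ 2 ≤ Real.exp 1 * (n : ℝ) ^ (-(2 * u)) := by
            rw [Real.rpow_def_of_pos hn0, ← Real.exp_add, ← Real.exp_nat_mul, Real.exp_le_exp]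
            push_cast
            have : u * (w + b) ≤ u * δ := mul_le_mul_of_nonneg_left (by linarith) hu
            change 2 * (u * w) ≤ 1 + b * _
            linarith
          have h5 := Real.exp_one_lt_d9
          calc _ ≤ _ := h4
            _ ≤ 3 * (n : ℝ) ^ (-(2 * σ)) := by
              apply mul_le_mul (by linarith) h3 (by positivity) (by norm_num)
        · rw [Set.indicator_of_notMem h, mul_zero]; exact zero_le
    _ = ENNReal.ofReal (3 * δ) * ENNReal.ofReal ((n : ℝ) ^ (-(2 * σ))) := by
        rw [lintegral_indicator measurableSet_Ioc, setLIntegral_const, Real.volume_Ioc,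
          ← ENNReal.ofReal_mul (by positivity), ← ENNReal.ofReal_mul (by positivity)]
        ring_nf

theorem lintegral_exp_rpow_le {δ u σ a K : ℝ} (hδ : 0 < δ) (hσu : σ ≤ u) (ha : a < 2 * σ)
    (ha0 : 0 ≤ a) (hK : 0 ≤ K) (huδ : u * δ ≤ 1 / 2) :
    ∫⁻ w in Set.Iic δ, ENNReal.ofReal (Real.exp (u * w) ^ 2 * (K * (2 * δ * Real.exp (-w)) ^ a))
      ≤ ENNReal.ofReal (K * (2 * δ) ^ a * (3 / (2 * σ - a))) := by
  have h1 : ∀ w, Real.exp (u * w) ^ 2 * (K * (2 * δ * Real.exp (-w)) ^ a)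
      = K * (2 * δ) ^ a * Real.exp ((2 * u - a) * w) := by
    intro w
    rw [Real.mul_rpow (by positivity) (Real.exp_pos _).le, ← Real.exp_mul, ← Real.exp_nat_mul]
    have : Real.exp ((2 * u - a) * w) = Real.exp ((2 : ℕ) * (u * w)) * Real.exp (-w * a) := by
      rw [← Real.exp_add]; push_cast; ring_nf
    rw [this]; ring
  simp only [h1]
  have h2 : 0 < 2 * u - a := by linarith
  rw [← ofReal_integral_eq_lintegral_ofReal ((integrableOn_exp_mul_Iic h2 δ).const_mul _)
    (Eventually.of_forall fun w => by positivity), integral_const_mul, integral_exp_mul_Iic h2]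
  apply ENNReal.ofReal_le_ofReal
  apply mul_le_mul_of_nonneg_left _ (by positivity)
  have h3 : Real.exp ((2 * u - a) * δ) ≤ 3 := by
    have h5 := Real.exp_one_lt_d9
    have : Real.exp ((2 * u - a) * δ) ≤ Real.exp 1 := by
      rw [Real.exp_le_exp]; nlinarith
    linarith
  exact div_le_div₀ (by norm_num) h3 (by linarith) (by linarith)

theorem lintegral_logIncr_le (q : ℕ) (hq : q ≠ 0) {δ u σ a : ℝ} (hδ : 0 < δ) (hδ1 : δ ≤ 1)
    (hσ : 0 < σ) (hσu : σ ≤ u) (ha : a < 2 * σ) (ha0 : 0 ≤ a) (ha2 : a ≤ 2)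
    (huδ : u * δ ≤ 1 / 2) :
    ∫⁻ w, ‖logIncr q δ u w‖ₑ ^ 2 ≤ ENNReal.ofReal (6 * δ) * coprimeTail q σ
      + ENNReal.ofReal (4 * (q + 3) ^ 2 * (2 * δ) ^ a * (3 / (2 * σ - a))) := by
  have hm : ∀ n : ℕ, Measurable fun w => ENNReal.ofReal (Real.exp (u * w) ^ 2) *
      (Set.Ico (Real.exp (-δ) * n) (n : ℝ)).indicator (fun _ => (1 : ℝ≥0∞)) (Real.exp (-w)) := by
    intro n
    refine Measurable.mul (by fun_prop) ?_
    exact (measurable_const.indicator measurableSet_Ico).comp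
      (by fun_prop : Measurable fun w : ℝ => Real.exp (-w))
  have hm' : ∀ n : ℕ, Measurable fun w => if 1 < n ∧ q.Coprime n then
      ENNReal.ofReal (Real.exp (u * w) ^ 2) *
      (Set.Ico (Real.exp (-δ) * n) (n : ℝ)).indicator (fun _ => (1 : ℝ≥0∞)) (Real.exp (-w))
      else 0 := by
    intro n
    split_ifs
    · exact hm n
    · exact measurable_const
  have hu : 0 ≤ u := by linarith
  set R : ℝ → ℝ≥0∞ := fun w =>
    ENNReal.ofReal (Real.exp (u * w) ^ 2 * (4 * (q + 3) ^ 2 * (2 * δ * Real.exp (-w)) ^ a))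
  have hR : Measurable R := by
    simp only [R]
    fun_prop
  calc ∫⁻ w, ‖logIncr q δ u w‖ₑ ^ 2
      ≤ ∫⁻ w, (2 * (∑' n : ℕ, if 1 < n ∧ q.Coprime n then
        ENNReal.ofReal (Real.exp (u * w) ^ 2) *
        (Set.Ico (Real.exp (-δ) * n) (n : ℝ)).indicator (fun _ => (1 : ℝ≥0∞)) (Real.exp (-w))
        else 0) + (Set.Iic δ).indicator R w) := by
        apply lintegral_mono
        intro w
        have h0 : ‖logIncr q δ u w‖ₑ ^ 2 = ENNReal.ofReal (Real.exp (u * w) ^ 2) *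
            ENNReal.ofReal (incrErr q δ (Real.exp (-w)) ^ 2) := by
          rw [← ofReal_norm, ← ENNReal.ofReal_pow (norm_nonneg _), logIncr, Complex.norm_real,
            Real.norm_eq_abs, sq_abs, mul_pow, ENNReal.ofReal_mul (by positivity)]
        dsimp only
        rw [h0]
        by_cases hw : w ≤ δ
        · rw [Set.indicator_of_mem (by exact hw)]
          refine (mul_le_mul_right (sq_incrErr_le q hq hδ hδ1 (Real.exp_pos _) ha0 ha2) _).trans
            (le_of_eq ?_)
          rw [mul_add, ← ENNReal.ofReal_mul (by positivity), mul_left_comm, ← ENNReal.tsum_mul_left]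
          simp only [mul_ite, mul_zero, R]
        · rw [incrErr_eq_zero q hδ.le (not_le.1 hw).le]
          simp
    _ = 2 * (∑' n : ℕ, ∫⁻ w, if 1 < n ∧ q.Coprime n then
        ENNReal.ofReal (Real.exp (u * w) ^ 2) *
        (Set.Ico (Real.exp (-δ) * n) (n : ℝ)).indicator (fun _ => (1 : ℝ≥0∞)) (Real.exp (-w))
        else 0) + ∫⁻ w in Set.Iic δ, R w := by
        rw [lintegral_add_left, lintegral_const_mul, lintegral_tsum,
          lintegral_indicator measurableSet_Iic]
        · exact fun n => (hm' n).aemeasurable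
        · exact Measurable.tsum hm'
        · exact (Measurable.tsum hm').const_mul _
    _ ≤ 2 * (∑' n : ℕ, ENNReal.ofReal (3 * δ) * if 1 < n ∧ q.Coprime n then
          ENNReal.ofReal ((n : ℝ) ^ (-(2 * σ))) else 0)
        + ENNReal.ofReal (4 * (q + 3) ^ 2 * (2 * δ) ^ a * (3 / (2 * σ - a))) := by
        gcongr with n
        · split_ifs with h
          · exact lintegral_exp_indicator_le hδ hσu hu huδ h.1
          · simp
        · exact lintegral_exp_rpow_le hδ hσu ha ha0 (by positivity) huδ
    _ = _ := by
        rw [ENNReal.tsum_mul_left, ← mul_assoc, coprimeTail]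
        congr 2
        rw [← ENNReal.ofReal_ofNat 2, ← ENNReal.ofReal_mul (by norm_num)]
        ring_nf

theorem coprimeTail_factorial_tendsto {σ : ℝ} (hσ : 1 / 2 < σ) :
    Tendsto (fun N : ℕ => coprimeTail N.factorial σ) atTop (nhds 0) := by
  have hs : ∑' n : ℕ, ENNReal.ofReal ((n : ℝ) ^ (-(2 * σ))) ≠ ∞ := by
    rw [← ENNReal.ofReal_tsum_of_nonneg (fun n => by positivity)
      (Real.summable_nat_rpow.2 (by linarith))]
    exact ENNReal.ofReal_ne_top
  have h := ENNReal.tendsto_sum_nat_add (fun n : ℕ => ENNReal.ofReal ((n : ℝ) ^ (-(2 * σ)))) hs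
  refine tendsto_of_tendsto_of_tendsto_of_le_of_le tendsto_const_nhds h (fun _ => zero_le) ?_
  intro N
  have hle : ∀ n : ℕ, 1 < n ∧ N.factorial.Coprime n → N ≤ n := by
    rintro n ⟨h1, h2⟩
    have := (Nat.coprime_factorial_iff (m := n) h1.ne').1 h2.symm
    exact this.le.trans (Nat.minFac_le (by omega))
  simp only [coprimeTail]
  rw [← Summable.sum_add_tsum_nat_add' (k := N) ENNReal.summable, Finset.sum_eq_zero, zero_add]
  · refine ENNReal.tsum_le_tsum fun n => ?_
    split_ifs
    · exact le_rfl
    · exact zero_le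
  · intro n hn
    rw [if_neg]
    intro h
    exact absurd (hle n h) (not_le.2 (Finset.mem_range.1 hn))

theorem lintegral_errFun_factorial_le {σ : ℝ} (hσ : 1 / 2 < σ) (hσ' : σ ≤ 3 / 2) (B : ℝ) {ε : ℝ}
    (hε : 0 < ε) : ∃ N₀ : ℕ, ∀ N ≥ N₀, ∃ T₀ : ℝ, 0 < T₀ ∧ ∀ T ≥ T₀, ∀ u ∈ Set.Icc σ B,
      ∫⁻ t in Set.Icc (-T) T, ‖errFun N.factorial (u + t * Complex.I)‖ₑ ^ 2
        ≤ ENNReal.ofReal (ε * T) := by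
  have hpi := Real.pi_pos
  have hη : 0 < ε / (2 * (192 * Real.pi)) := by positivity
  obtain ⟨N₀, hN₀⟩ := eventually_atTop.1 ((ENNReal.tendsto_nhds_zero.1
    (coprimeTail_factorial_tendsto hσ)) _ (ENNReal.ofReal_pos.2 hη))
  refine ⟨N₀, fun N hN => ?_⟩
  set q := N.factorial with hq
  have hq0 : q ≠ 0 := Nat.factorial_ne_zero N
  set a := σ + 1 / 2 with ha
  set K : ℝ := 128 * Real.pi * (4 * (q + 3) ^ 2 * (3 / (2 * σ - a))) with hK
  have hlim : Tendsto (fun T : ℝ => K * (1 / 2) ^ a * T ^ (-(a - 1))) atTop (nhds 0) := by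
    rw [← mul_zero (K * (1 / 2) ^ a)]
    exact (tendsto_rpow_neg_atTop (by linarith)).const_mul _
  obtain ⟨T₁, hT₁⟩ := eventually_atTop.1 (hlim.eventually (gt_mem_nhds (half_pos hε)))
  refine ⟨max T₁ (max 1 B), by positivity, fun T hT u hu => ?_⟩
  have hTT₁ : T₁ ≤ T := (le_max_left _ _).trans hT
  have hT1 : 1 ≤ T := (le_max_left _ _).trans ((le_max_right _ _).trans hT)
  have hTB : B ≤ T := (le_max_right _ _).trans ((le_max_right _ _).trans hT)
  have hT0 : 0 < T := by linarith
  have huT : u ≤ T := hu.2.trans hTB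
  have hu0 : 0 < u := by linarith [hu.1]
  have hδ1 : 1 / (4 * T) ≤ 1 := by
    rw [div_le_one (by positivity)]; linarith
  have huδ : u * (1 / (4 * T)) ≤ 1 / 2 := by
    rw [mul_one_div, div_le_iff₀ (by positivity)]; linarith
  have h1 := lintegral_errFun_le q hq0 hu0 hT0 huT
  have h2 := lintegral_logIncr_le q hq0 (σ := σ) (a := a) (by positivity) hδ1 (by linarith)
    hu.1 (by linarith) (by linarith) (by linarith) huδ
  have h3 := hT₁ T hTT₁
  calc _ ≤ _ := h1
    _ ≤ ENNReal.ofReal (128 * Real.pi * T ^ 2) * (ENNReal.ofReal (6 * (1 / (4 * T))) *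
        ENNReal.ofReal (ε / (2 * (192 * Real.pi)))
        + ENNReal.ofReal (4 * (q + 3) ^ 2 * (2 * (1 / (4 * T))) ^ a * (3 / (2 * σ - a)))) := by
        gcongr
        refine h2.trans ?_
        gcongr
        exact hN₀ N hN
    _ = ENNReal.ofReal (ε / 2 * T + K * (1 / 2) ^ a * T ^ (-(a - 1)) * T) := by
        have h4 : 0 < 2 * σ - a := by linarith
        rw [← ENNReal.ofReal_mul (by positivity), ← ENNReal.ofReal_add (by positivity)
          (by positivity), ← ENNReal.ofReal_mul (by positivity)]
        congr 1
        have h5 : (2 * (1 / (4 * T))) ^ a = (1 / 2) ^ a * (T ^ (-(a - 1)) * T / T ^ 2) := by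
          rw [show 2 * (1 / (4 * T)) = 1 / 2 * T⁻¹ by field_simp; norm_num,
            Real.mul_rpow (by norm_num) (by positivity), Real.inv_rpow hT0.le, ← Real.rpow_neg hT0.le,
            show -(a - 1) = -a + 1 by ring, Real.rpow_add hT0, Real.rpow_one]
          field_simp
        rw [h5, hK]
        field_simp
        ring
    _ ≤ ENNReal.ofReal (ε * T) := by
        apply ENNReal.ofReal_le_ofReal
        nlinarith

end

section

open scoped Finset ENNReal

theorem enorm_deriv_le_lintegral {G : ℂ → ℂ} {U : Set ℂ} (hU : IsOpen U)
    (hG : DifferentiableOn ℂ G U) {s : ℂ} {r : ℝ} (hr : 0 < r)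
    (hs : Metric.closedBall s r ⊆ U) :
    ‖deriv G s‖ₑ ≤ ENNReal.ofReal (1 / (2 * Real.pi * r)) *
      ∫⁻ θ in Set.Ioc 0 (2 * Real.pi), ‖G (circleMap s r θ)‖ₑ := by
  have hpi := Real.pi_pos
  have h := Complex.two_pi_I_inv_smul_circleIntegral_sub_sq_inv_smul_of_differentiable hU hs hG
    (Metric.mem_ball_self hr)
  rw [← h, enorm_smul, circleIntegral, intervalIntegral.integral_of_le (by positivity)]
  have h1 : ‖(2 * Real.pi * Complex.I : ℂ)⁻¹‖ₑ = ENNReal.ofReal (1 / (2 * Real.pi)) := by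
    rw [← ofReal_norm, norm_inv]
    congr 1
    simp [abs_of_pos hpi]
  have h2 : ENNReal.ofReal (1 / (2 * Real.pi * r))
      = ENNReal.ofReal (1 / (2 * Real.pi)) * ENNReal.ofReal (1 / r) := by
    rw [← ENNReal.ofReal_mul (by positivity)]
    congr 1
    field_simp
  rw [h1, h2, mul_assoc]
  gcongr
  refine (enorm_integral_le_lintegral_enorm _).trans (le_of_eq ?_)
  rw [← lintegral_const_mul' _ _ ENNReal.ofReal_ne_top]
  congr 1
  ext θ
  rw [enorm_smul, enorm_smul, ← mul_assoc]
  congr 1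
  rw [← ofReal_norm, ← ofReal_norm, ← ENNReal.ofReal_mul (norm_nonneg _)]
  congr 1
  rw [deriv_circleMap, norm_mul, norm_inv, norm_pow, circleMap_sub_center]
  simp only [norm_circleMap_zero, Complex.norm_I, mul_one, abs_of_pos hr]
  field_simp

theorem exists_exceptional_set {G : ℂ → ℂ} (hG : ∀ s : ℂ, 0 < s.re → DifferentiableAt ℂ G s)
    {σ σ₀ r B T η : ℝ} {A : ℝ≥0∞} (hσ₀ : 0 < σ₀) (hr : 0 < r) (hr1 : r ≤ 1)
    (hσ : σ₀ + r ≤ σ) (h2 : σ₀ + r ≤ 2) (hσB : σ + r ≤ B) (h2B : 2 + r ≤ B) (hη : 0 < η)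
    (hA : ∀ u ∈ Set.Icc σ₀ B,
      ∫⁻ t in Set.Icc (-(T + 1)) (T + 1), ‖G (u + t * Complex.I)‖ₑ ≤ A) :
    ∃ Bad : Set ℝ, volume Bad ≤ ENNReal.ofReal ((1 + |2 - σ| / r) / η) * A ∧
      ∀ t ∈ Set.Icc (-T) T, t ∉ Bad → ∀ u ∈ Set.uIcc σ 2, ‖G (u + t * Complex.I)‖ ≤ η := by
  have hpi := Real.pi_pos
  set U : Set ℂ := {z | 0 < z.re}
  have hU : IsOpen U := isOpen_lt continuous_const Complex.continuous_re
  have hGU : DifferentiableOn ℂ G U := fun z hz => (hG z hz).differentiableWithinAt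
  set H : ℂ → ℝ≥0∞ := fun s => U.indicator (fun s => ‖G s‖ₑ) s with hH
  have hHm : Measurable H := by
    classical
    have : ContinuousOn (fun s => ‖G s‖ₑ) U := hGU.continuousOn.enorm
    have := this.measurable_piecewise (g := fun _ => (0 : ℝ≥0∞)) continuousOn_const hU.measurableSet
    simpa [hH, Set.piecewise_eq_indicator] using! this
  have hHG : ∀ s : ℂ, 0 < s.re → H s = ‖G s‖ₑ := fun s hs =>
    Set.indicator_of_mem (show s ∈ U from hs) _
  set c : ℝ≥0∞ := ENNReal.ofReal (1 / (2 * Real.pi * r)) with hc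
  set M : ℝ → ℝ≥0∞ := fun t => H (2 + t * Complex.I) + c * ∫⁻ x in Set.uIoc 2 σ,
    ∫⁻ θ in Set.Ioc 0 (2 * Real.pi), H (circleMap (x + t * Complex.I) r θ) with hM
  have hm3 : Measurable fun p : (ℝ × ℝ) × ℝ =>
      H (circleMap (p.1.2 + p.1.1 * Complex.I) r p.2) := by
    refine hHm.comp ?_
    unfold circleMap
    fun_prop
  have hm2 : Measurable fun p : ℝ × ℝ => ∫⁻ θ in Set.Ioc 0 (2 * Real.pi),
      H (circleMap (p.2 + p.1 * Complex.I) r θ) := hm3.lintegral_prod_right'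
  have hm1 : Measurable fun t : ℝ => ∫⁻ x in Set.uIoc 2 σ,
    ∫⁻ θ in Set.Ioc 0 (2 * Real.pi), H (circleMap (x + t * Complex.I) r θ) :=
    hm2.lintegral_prod_right'
  have hm0 : Measurable fun t : ℝ => H (2 + t * Complex.I) := hHm.comp (by fun_prop)
  have hMm : Measurable M := hm0.add (hm1.const_mul _)
  have hpt : ∀ t : ℝ, ∀ u ∈ Set.uIcc σ 2, ‖G (u + t * Complex.I)‖ₑ ≤ M t := by
    intro t u hu
    have hpos : ∀ x ∈ Set.uIcc σ 2, σ₀ + r ≤ x := fun x hx =>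
      (le_min hσ h2).trans hx.1
    have hsub : Set.uIcc 2 u ⊆ Set.uIcc σ 2 :=
      Set.uIcc_subset_uIcc Set.right_mem_uIcc hu
    have hd : ∀ x ∈ Set.uIcc 2 u, HasDerivAt (fun x : ℝ => G (x + t * Complex.I))
        (deriv G (x + t * Complex.I)) x := by
      intro x hx
      have h3 := hpos x (hsub hx)
      have h1 : HasDerivAt G (deriv G (x + t * Complex.I)) (x + t * Complex.I) :=
        (hG _ (by simp; linarith)).hasDerivAt
      have h4 : HasDerivAt (fun z : ℂ => z + t * Complex.I) 1 (x : ℂ) :=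
        (hasDerivAt_id _).add_const _
      have := (HasDerivAt.comp (x : ℂ) h1 h4).comp_ofReal
      simpa using! this
    have hcont : ContinuousOn (fun x : ℝ => deriv G (x + t * Complex.I)) (Set.uIcc 2 u) := by
      refine ((hGU.deriv hU).continuousOn).comp (by fun_prop) ?_
      intro x hx
      have h3 := hpos x (hsub hx)
      change 0 < Complex.re _
      simp; linarith
    have hftc := intervalIntegral.integral_eq_sub_of_hasDerivAt hd hcont.intervalIntegrable
    have h5 : G (u + t * Complex.I) = G (2 + t * Complex.I)
        + ∫ x in (2 : ℝ)..u, deriv G (x + t * Complex.I) := by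
      rw [hftc]; simp
    rw [h5, hM]
    refine (enorm_add_le _ _).trans ?_
    dsimp only
    rw [hHG _ (by simp), ← lintegral_const_mul' _ _ ENNReal.ofReal_ne_top]
    gcongr
    rw [← ofReal_norm, intervalIntegral.norm_integral_eq_norm_integral_uIoc, ofReal_norm]
    refine (enorm_integral_le_lintegral_enorm _).trans ?_
    refine le_trans ?_ (lintegral_mono_set (s := Set.uIoc 2 u) ?_)
    · refine setLIntegral_mono_ae' measurableSet_uIoc (Eventually.of_forall fun x hx => ?_)
      have h3 := hpos x (hsub (Set.uIoc_subset_uIcc hx))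
      have hball : ∀ z ∈ Metric.closedBall ((x : ℂ) + t * Complex.I) r, 0 < z.re := by
        intro z hz
        rw [mem_closedBall_iff_norm] at hz
        have h6 := (Complex.abs_re_le_norm (z - (x + t * Complex.I))).trans hz
        simp at h6
        have := (abs_le.1 h6).1
        linarith
      refine (enorm_deriv_le_lintegral hU hGU hr hball).trans (le_of_eq ?_)
      congr 1
      refine lintegral_congr fun θ => ?_
      rw [hHG _ (hball _ (circleMap_mem_closedBall _ hr.le θ))]
    · intro x hx
      rcases Set.mem_uIoc.1 hx with h | h
      · rcases Set.mem_uIcc.1 hu with h' | h'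
        · linarith [h.1, h.2]
        · exact Set.mem_uIoc.2 (Or.inl ⟨h.1, h.2.trans h'.2⟩)
      · rcases Set.mem_uIcc.1 hu with h' | h'
        · exact Set.mem_uIoc.2 (Or.inr ⟨lt_of_le_of_lt h'.1 h.1, h.2⟩)
        · linarith [h.1, h.2]
  have hI : ∀ x : ℝ, ∀ y : ℝ, x ∈ Set.Icc σ₀ B → |y| ≤ 1 →
      ∫⁻ t in Set.Icc (-T) T, H (x + (t + y) * Complex.I) ≤ A := by
    intro x y hx hy
    have e := abs_le.1 hy
    have h6 := (measurePreserving_add_right (volume : Measure ℝ) y).setLIntegral_comp_preimage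
      (s := Set.Icc (-T + y) (T + y)) measurableSet_Icc
      (f := fun t => H (x + t * Complex.I)) (hHm.comp (by fun_prop))
    have h7 : (fun t : ℝ => t + y) ⁻¹' Set.Icc (-T + y) (T + y) = Set.Icc (-T) T := by
      ext t; simp
    rw [h7] at h6
    push_cast at h6
    rw [h6]
    calc _ ≤ ∫⁻ t in Set.Icc (-(T + 1)) (T + 1), H (x + t * Complex.I) :=
          lintegral_mono_set (Set.Icc_subset_Icc (by linarith) (by linarith))
      _ = ∫⁻ t in Set.Icc (-(T + 1)) (T + 1), ‖G (x + t * Complex.I)‖ₑ := by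
          refine lintegral_congr fun t => hHG _ ?_
          simp; linarith [hx.1]
      _ ≤ A := hA x hx
  have hInt : ∫⁻ t in Set.Icc (-T) T, M t ≤ ENNReal.ofReal (1 + |2 - σ| / r) * A := by
    rw [hM, lintegral_add_left hm0, lintegral_const_mul _ hm1]
    have h8 : ∫⁻ t in Set.Icc (-T) T, H (2 + t * Complex.I) ≤ A := by
      have := hI 2 0 ⟨by linarith, by linarith⟩ (by simp)
      simpa using this
    have h9 : ∫⁻ t in Set.Icc (-T) T, ∫⁻ x in Set.uIoc 2 σ,
        ∫⁻ θ in Set.Ioc 0 (2 * Real.pi), H (circleMap (x + t * Complex.I) r θ)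
        ≤ ENNReal.ofReal (|2 - σ| * (2 * Real.pi)) * A := by
      rw [lintegral_lintegral_swap (f := fun t x : ℝ => ∫⁻ θ in Set.Ioc 0 (2 * Real.pi),
        H (circleMap (x + t * Complex.I) r θ)) hm2.aemeasurable]
      calc _ ≤ ∫⁻ x in Set.uIoc 2 σ, ∫⁻ θ in Set.Ioc 0 (2 * Real.pi), A := by
            refine setLIntegral_mono_ae' measurableSet_uIoc (Eventually.of_forall fun x hx => ?_)
            rw [lintegral_lintegral_swap]
            · refine lintegral_mono fun θ => ?_
              have hx' := Set.uIoc_subset_uIcc hx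
              have hx1 : σ₀ + r ≤ x := (le_min h2 hσ).trans hx'.1
              have hx2 : x + r ≤ B := by
                have : x ≤ max 2 σ := hx'.2
                have : max 2 σ ≤ B - r := max_le (by linarith) (by linarith)
                linarith
              have hcos : |r * Real.cos θ| ≤ r := by
                rw [abs_mul, abs_of_pos hr]
                exact mul_le_of_le_one_right hr.le (Real.abs_cos_le_one θ)
              have hsin : |r * Real.sin θ| ≤ 1 := by
                rw [abs_mul, abs_of_pos hr]
                nlinarith [Real.abs_sin_le_one θ, abs_nonneg (Real.sin θ)]
              have h10 := abs_le.1 hcos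
              have h11 := hI (x + r * Real.cos θ) (r * Real.sin θ)
                ⟨by linarith, by linarith⟩ hsin
              refine (lintegral_congr fun t => ?_).trans_le h11
              congr 1
              rw [circleMap, Complex.exp_mul_I]
              push_cast
              ring
            · have : Measurable fun p : ℝ × ℝ => H (circleMap (x + p.1 * Complex.I) r p.2) :=
                hm3.comp (by fun_prop : Measurable fun p : ℝ × ℝ => ((p.1, x), p.2))
              exact this.aemeasurable
        _ = ENNReal.ofReal (|2 - σ| * (2 * Real.pi)) * A := by
            rw [setLIntegral_const, setLIntegral_const, Real.volume_Ioc, Real.volume_uIoc,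
              ENNReal.ofReal_mul (abs_nonneg _), abs_sub_comm]
            ring_nf
    calc _ ≤ A + c * (ENNReal.ofReal (|2 - σ| * (2 * Real.pi)) * A) := by gcongr
      _ = ENNReal.ofReal (1 + |2 - σ| / r) * A := by
        rw [ENNReal.ofReal_add zero_le_one (by positivity), ENNReal.ofReal_one, add_mul, one_mul,
          ← mul_assoc, hc, ← ENNReal.ofReal_mul (by positivity)]
        congr 3
        field_simp
  refine ⟨{t | ENNReal.ofReal η ≤ M t} ∩ Set.Icc (-T) T, ?_, ?_⟩
  · rw [← Measure.restrict_apply (measurableSet_le measurable_const hMm)]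
    refine (meas_ge_le_lintegral_div hMm.aemeasurable (ENNReal.ofReal_pos.2 hη).ne'
      ENNReal.ofReal_ne_top).trans ?_
    rw [ENNReal.div_le_iff (ENNReal.ofReal_pos.2 hη).ne' ENNReal.ofReal_ne_top]
    refine hInt.trans (le_of_eq ?_)
    rw [mul_right_comm, ← ENNReal.ofReal_mul (by positivity)]
    congr 2
    field_simp
  · intro t ht hb u hu
    have h12 : M t < ENNReal.ofReal η := by
      by_contra h; exact hb ⟨not_lt.1 h, ht⟩
    have h13 := ((hpt t u hu).trans_lt h12).le
    rwa [← ofReal_norm, ENNReal.ofReal_le_ofReal_iff hη.le] at h13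

theorem exists_exceptional_errFun {σ : ℝ} (hσ : 1 / 2 < σ) {η : ℝ} (hη : 0 < η) :
    ∃ N₀ : ℕ, ∀ N ≥ N₀, ∃ T₀ : ℝ, 0 < T₀ ∧ ∀ T ≥ T₀, ∃ Bad : Set ℝ,
      volume Bad ≤ ENNReal.ofReal (η * T) ∧ ∀ t ∈ Set.Icc (-T) T, t ∉ Bad →
        ∀ u ∈ Set.uIcc σ 2, ‖errFun N.factorial (u + t * Complex.I)‖ ≤ η := by
  set m := min σ 2 with hm
  have hm1 : 1 / 2 < m := lt_min hσ (by norm_num)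
  have hm2 : m ≤ 2 := min_le_right _ _
  have hmσ : m ≤ σ := min_le_left _ _
  set r := (m - 1 / 2) / 2 with hr
  have hr0 : 0 < r := by linarith
  set σ₀ := m - r with hσ₀
  set B := max σ 2 + 1
  have hB1 : σ ≤ max σ 2 := le_max_left _ _
  have hB2 : 2 ≤ max σ 2 := le_max_right _ _
  set K := (1 + |2 - σ| / r) / η with hK
  have hK0 : 0 < K := by positivity
  set η' := η / (4 * K) with hη'
  have hη'0 : 0 < η' := by positivity
  obtain ⟨N₀, hN₀⟩ := lintegral_errFun_factorial_le (σ := σ₀) (by linarith) (by linarith) B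
    (pow_pos hη'0 2)
  refine ⟨N₀, fun N hN => ?_⟩
  obtain ⟨T₀, hT₀, h⟩ := hN₀ N hN
  refine ⟨max T₀ 3, by positivity, fun T hT => ?_⟩
  have hT1 : T₀ ≤ T := (le_max_left _ _).trans hT
  have hT2 : 3 ≤ T := (le_max_right _ _).trans hT
  have hq : N.factorial ≠ 0 := N.factorial_ne_zero
  have hA : ∀ u ∈ Set.Icc σ₀ B, ∫⁻ t in Set.Icc (-(T + 1)) (T + 1),
      ‖errFun N.factorial (u + t * Complex.I)‖ₑ ≤ ENNReal.ofReal (3 * η' * (T + 1)) := by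
    intro u hu
    have h1 := h (T + 1) (by linarith) u hu
    calc ∫⁻ t in Set.Icc (-(T + 1)) (T + 1), ‖errFun N.factorial (u + t * Complex.I)‖ₑ
        ≤ ∫⁻ t in Set.Icc (-(T + 1)) (T + 1), (ENNReal.ofReal η' + ENNReal.ofReal η'⁻¹ *
          ‖errFun N.factorial (u + t * Complex.I)‖ₑ ^ 2) := by
          apply lintegral_mono
          intro t
          dsimp only
          rw [← ofReal_norm, ← ENNReal.ofReal_pow (norm_nonneg _),
            ← ENNReal.ofReal_mul (by positivity), ← ENNReal.ofReal_add (by positivity)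
            (by positivity)]
          apply ENNReal.ofReal_le_ofReal
          set y := ‖errFun N.factorial (u + t * Complex.I)‖
          have : 0 ≤ η'⁻¹ * ((y - η') ^ 2 + y * η') := by positivity
          have e : η'⁻¹ * ((y - η') ^ 2 + y * η') = η' + η'⁻¹ * y ^ 2 - y := by
            field_simp; ring
          linarith
      _ ≤ ENNReal.ofReal η' * ENNReal.ofReal (2 * (T + 1))
          + ENNReal.ofReal η'⁻¹ * ENNReal.ofReal (η' ^ 2 * (T + 1)) := by
          rw [lintegral_add_left measurable_const, setLIntegral_const, Real.volume_Icc,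
            lintegral_const_mul' _ _ ENNReal.ofReal_ne_top]
          gcongr
          linarith
      _ = ENNReal.ofReal (3 * η' * (T + 1)) := by
          rw [← ENNReal.ofReal_mul (by positivity), ← ENNReal.ofReal_mul (by positivity),
            ← ENNReal.ofReal_add (by positivity) (by positivity)]
          congr 1
          field_simp
          ring
  obtain ⟨Bad, hBad, hgood⟩ := exists_exceptional_set (G := errFun N.factorial)
    (fun s hs => differentiableAt_errFun _ hq hs) (σ := σ) (σ₀ := σ₀) (r := r) (B := B) (T := T)
    (η := η) (A := ENNReal.ofReal (3 * η' * (T + 1))) (by linarith) hr0 (by linarith) (by linarith)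
    (by linarith) (by linarith) (by linarith) hη hA
  refine ⟨Bad, hBad.trans ?_, hgood⟩
  rw [← ENNReal.ofReal_mul hK0.le]
  apply ENNReal.ofReal_le_ofReal
  calc K * (3 * η' * (T + 1)) = η * (3 / 4 * (T + 1)) := by rw [hη']; field_simp
    _ ≤ η * T := by gcongr; linarith

end

section

open scoped Finset ENNReal

/-- The logarithm of the partial Euler product of `ζ` over the primes dividing `N!`. -/
noncomputable def logEuler (N : ℕ) (s : ℂ) : ℂ :=
  ∑ p ∈ N.factorial.primeFactors, -Complex.log (1 - (p : ℂ) ^ (-s))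

theorem norm_prime_cpow_lt_one {p : ℕ} (hp : p.Prime) {s : ℂ} (hs : 0 < s.re) :
    ‖(p : ℂ) ^ (-s)‖ < 1 := by
  rw [Complex.norm_natCast_cpow_of_pos hp.pos, Complex.neg_re]
  exact Real.rpow_lt_one_of_one_lt_of_neg (by exact_mod_cast hp.one_lt) (by linarith)

theorem one_sub_prime_cpow_mem_slitPlane {p : ℕ} (hp : p.Prime) {s : ℂ} (hs : 0 < s.re) :
    1 - (p : ℂ) ^ (-s) ∈ Complex.slitPlane := by
  rw [sub_eq_add_neg]
  exact Complex.mem_slitPlane_of_norm_lt_one (by rw [norm_neg]; exact norm_prime_cpow_lt_one hp hs)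

theorem exp_neg_logEuler (N : ℕ) {s : ℂ} (hs : 0 < s.re) :
    Complex.exp (-logEuler N s) = ∏ p ∈ N.factorial.primeFactors, (1 - (p : ℂ) ^ (-s)) := by
  rw [logEuler, Finset.sum_neg_distrib, neg_neg, Complex.exp_sum]
  refine Finset.prod_congr rfl fun p hp => ?_
  exact Complex.exp_log (Complex.slitPlane_ne_zero
    (one_sub_prime_cpow_mem_slitPlane (Nat.prime_of_mem_primeFactors hp) hs))

theorem zeta_mul_exp_neg_logEuler (N : ℕ) {s : ℂ} (hs : 0 < s.re) (hs1 : s ≠ 1) :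
    riemannZeta s * Complex.exp (-logEuler N s) = 1 + (errFun N.factorial s
      + ((N.factorial.totient / N.factorial : ℝ) : ℂ) / (s - 1)) := by
  have : NeZero N.factorial := ⟨N.factorial_ne_zero⟩
  rw [errFun_eq _ hs hs1, DirichletCharacter.LFunctionTrivChar_eq_mul_riemannZeta hs1,
    exp_neg_logEuler N hs]
  ring

theorem differentiableAt_logEuler (N : ℕ) {s : ℂ} (hs : 0 < s.re) :
    DifferentiableAt ℂ (logEuler N) s := by
  unfold logEuler
  refine DifferentiableAt.fun_sum fun p hp => ?_
  have hpp := Nat.prime_of_mem_primeFactors hp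
  have h0 : (p : ℂ) ≠ 0 := by exact_mod_cast hpp.ne_zero
  have h : DifferentiableAt ℂ (fun z : ℂ => 1 - (p : ℂ) ^ (-z)) s :=
    (differentiableAt_fun_id.fun_neg.const_cpow (Or.inl h0)).const_sub 1
  exact (h.clog (one_sub_prime_cpow_mem_slitPlane hpp hs)).fun_neg

theorem norm_neg_log_one_sub_prime_cpow_le {p : ℕ} (hp : p.Prime) {s : ℂ} (hs : s.re = 2) :
    ‖-Complex.log (1 - (p : ℂ) ^ (-s))‖ ≤ 3 / 2 * (1 / (p : ℝ) ^ 2) := by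
  have h2 : (2 : ℝ) ≤ p := by exact_mod_cast hp.two_le
  have h1 : ‖-(p : ℂ) ^ (-s)‖ = 1 / (p : ℝ) ^ 2 := by
    rw [norm_neg, Complex.norm_natCast_cpow_of_pos hp.pos, Complex.neg_re, hs, Real.rpow_neg
      (by positivity), one_div]
    norm_cast
  have h3 : 1 / (p : ℝ) ^ 2 ≤ 1 / 2 := by
    rw [div_le_div_iff₀ (by positivity) (by norm_num)]
    nlinarith
  rw [norm_neg, sub_eq_add_neg]
  have := Complex.norm_log_one_add_half_le_self (z := -(p : ℂ) ^ (-s)) (by rw [h1]; exact h3)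
  rwa [h1] at this

theorem norm_tsum_sub_logEuler_le (N : ℕ) {s : ℂ} (hs : s.re = 2) :
    ‖(∑' p : Nat.Primes, -Complex.log (1 - (p : ℂ) ^ (-s))) - logEuler N s‖
      ≤ 3 / 2 * (Real.pi ^ 2 / 6) := by
  set g : ℕ → ℂ := fun p => -Complex.log (1 - (p : ℂ) ^ (-s))
  set P : Set ℕ := {p | p.Prime}
  have hb : HasSum (fun n : ℕ => 3 / 2 * (1 / (n : ℝ) ^ 2)) (3 / 2 * (Real.pi ^ 2 / 6)) :=
    hasSum_zeta_two.mul_left _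
  have hle : ∀ n, ‖P.indicator g n‖ ≤ 3 / 2 * (1 / (n : ℝ) ^ 2) := by
    intro n
    by_cases h : n ∈ P
    · rw [Set.indicator_of_mem h]
      exact norm_neg_log_one_sub_prime_cpow_le h hs
    · rw [Set.indicator_of_notMem h, norm_zero]; positivity
  have hS : Summable (P.indicator g) := hb.summable.of_norm_bounded hle
  have h1 : (∑' p : Nat.Primes, g p) = ∑' n, P.indicator g n := tsum_subtype P g
  have h2 : HasSum (fun n => if n ∈ N.factorial.primeFactors then P.indicator g n else 0)
      (logEuler N s) := by
    have : logEuler N s = ∑ n ∈ N.factorial.primeFactors,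
        if n ∈ N.factorial.primeFactors then P.indicator g n else 0 := by
      refine Finset.sum_congr rfl fun p hp => ?_
      rw [if_pos hp, Set.indicator_of_mem (show p ∈ P from Nat.prime_of_mem_primeFactors hp)]
    rw [this]
    exact hasSum_sum_of_ne_finset_zero fun n hn => if_neg hn
  have h3 := hS.hasSum.sub h2
  rw [← h1] at h3
  refine h3.norm_le_of_bounded hb fun n => ?_
  split_ifs
  · rw [sub_self, norm_zero]; positivity
  · rw [sub_zero]; exact hle n

theorem tsum_tsum_eq_tsum_log (t : ℝ) :
    (∑' p : Nat.Primes, ∑' k : ℕ,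
      ((p : ℕ) : ℂ) ^ (-((k : ℂ) + 1) * (2 + t * Complex.I)) / ((k : ℂ) + 1))
    = ∑' p : Nat.Primes, -Complex.log (1 - ((p : ℕ) : ℂ) ^ (-(2 + t * Complex.I))) := by
  refine tsum_congr fun p => ?_
  have h := Complex.hasSum_taylorSeries_neg_log' (norm_prime_cpow_lt_one p.2
    (s := 2 + t * Complex.I) (by simp))
  rw [← h.tsum_eq]
  refine tsum_congr fun k => ?_
  rw [← Complex.cpow_nat_mul]
  push_cast
  ring_nf

theorem logZetaLine_sub_logEuler {σ : ℝ} (hσ : 0 < σ) (N : ℕ) {t : ℝ} (ht : t ≠ 0)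
    (hR : ∀ u ∈ Set.uIcc σ 2, ‖errFun N.factorial (u + t * Complex.I)
      + ((N.factorial.totient / N.factorial : ℝ) : ℂ) / (u + t * Complex.I - 1)‖ ≤ 1 / 2) :
    t ∈ OmegaZeta σ ∧ logZetaLine σ t - logEuler N (σ + t * Complex.I)
      = Complex.log (1 + (errFun N.factorial (σ + t * Complex.I)
      + ((N.factorial.totient / N.factorial : ℝ) : ℂ) / (σ + t * Complex.I - 1))) := by
  set R : ℂ → ℂ := fun s => errFun N.factorial s
      + ((N.factorial.totient / N.factorial : ℝ) : ℂ) / (s - 1) with hRdef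
  have hmem2 : (2 : ℝ) ∈ Set.uIcc σ 2 := Set.right_mem_uIcc
  have hmemσ : σ ∈ Set.uIcc σ 2 := Set.left_mem_uIcc
  have hpos : ∀ u ∈ Set.uIcc σ 2, 0 < u := fun u hu => (lt_min hσ two_pos).trans_le hu.1
  have hre : ∀ u ∈ Set.uIcc σ 2, 0 < ((u : ℂ) + t * Complex.I).re := fun u hu => by
    simpa using hpos u hu
  have hne1 : ∀ u : ℝ, (u : ℂ) + t * Complex.I ≠ 1 := fun u h => by
    have := congrArg Complex.im h
    simp at this
    exact ht this
  have hz : ∀ u ∈ Set.uIcc σ 2, riemannZeta (u + t * Complex.I)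
      * Complex.exp (-logEuler N (u + t * Complex.I)) = 1 + R (u + t * Complex.I) := fun u hu =>
    zeta_mul_exp_neg_logEuler N (hre u hu) (hne1 u)
  have hslit : ∀ u ∈ Set.uIcc σ 2, 1 + R (u + t * Complex.I) ∈ Complex.slitPlane := fun u hu =>
    Complex.mem_slitPlane_of_norm_lt_one (by have := hR u hu; simp only [hRdef]; linarith)
  have hzne : ∀ u ∈ Set.uIcc σ 2, riemannZeta (u + t * Complex.I) ≠ 0 := by
    intro u hu h
    have h1 := Complex.slitPlane_ne_zero (hslit u hu)
    rw [← hz u hu, h, zero_mul] at h1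
    exact h1 rfl
  refine ⟨fun u hu => hzne u (Set.Icc_subset_uIcc hu), ?_⟩
  set L : ℂ → ℂ := fun s => logEuler N s
    + Complex.log (riemannZeta s * Complex.exp (-logEuler N s)) with hL
  have hd : ∀ u ∈ Set.uIcc σ 2, HasDerivAt (fun x : ℝ => L (x + t * Complex.I))
      (deriv riemannZeta (u + t * Complex.I) / riemannZeta (u + t * Complex.I)) u := by
    intro u hu
    have h1 : HasDerivAt (logEuler N) (deriv (logEuler N) (u + t * Complex.I))
        (u + t * Complex.I) := (differentiableAt_logEuler N (hre u hu)).hasDerivAt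
    have h2 : HasDerivAt riemannZeta (deriv riemannZeta (u + t * Complex.I))
        (u + t * Complex.I) := (differentiableAt_riemannZeta (hne1 u)).hasDerivAt
    have h3 := h1.add ((h2.mul h1.neg.cexp).clog (by
      simp only [Pi.mul_apply, Pi.neg_apply]; rw [hz u hu]; exact hslit u hu))
    have h4 : HasDerivAt (fun z : ℂ => z + t * Complex.I) 1 (u : ℂ) :=
      (hasDerivAt_id _).add_const _
    have h5 := (HasDerivAt.comp (u : ℂ) h3 h4).comp_ofReal
    refine (h5.congr_deriv ?_)
    have h6 := hzne u hu
    have h7 := Complex.exp_ne_zero (-logEuler N (u + t * Complex.I))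
    simp only [Pi.neg_apply, Pi.mul_apply]
    field_simp
    ring
  have hcont : ContinuousOn (fun u : ℝ => deriv riemannZeta (u + t * Complex.I)
      / riemannZeta (u + t * Complex.I)) (Set.uIcc σ 2) := by
    have hζ : DifferentiableOn ℂ riemannZeta {1}ᶜ := fun z hz =>
      (differentiableAt_riemannZeta hz).differentiableWithinAt
    refine ContinuousOn.div ?_ ?_ hzne
    · exact ((hζ.deriv isOpen_compl_singleton).continuousOn).comp (by fun_prop)
        fun u _ => hne1 u
    · exact hζ.continuousOn.comp (by fun_prop) fun u _ => hne1 u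
  have hftc := intervalIntegral.integral_eq_sub_of_hasDerivAt hd hcont.intervalIntegrable
  have hT : (∑' p : Nat.Primes, -Complex.log (1 - ((p : ℕ) : ℂ) ^ (-(2 + t * Complex.I))))
      = L (2 + t * Complex.I) := by
    set Θ := ∑' p : Nat.Primes, -Complex.log (1 - ((p : ℕ) : ℂ) ^ (-(2 + t * Complex.I)))
    have h1 : Complex.exp Θ = Complex.exp (L (2 + t * Complex.I)) := by
      rw [riemannZeta_eulerProduct_exp_log (by simp), hL]
      have h2 := hzne 2 hmem2
      push_cast at h2
      simp only
      rw [Complex.exp_add, Complex.exp_log (mul_ne_zero h2 (Complex.exp_ne_zero _)), mul_left_comm,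
        ← Complex.exp_add, add_neg_cancel, Complex.exp_zero, mul_one]
    obtain ⟨n, hn⟩ := Complex.exp_eq_exp_iff_exists_int.1 h1
    have h3 := norm_tsum_sub_logEuler_le N (s := 2 + t * Complex.I) (by simp)
    have h4 : ‖Complex.log (1 + R (2 + t * Complex.I))‖ ≤ 3 / 4 := by
      have h5 := hR 2 hmem2
      rw [Complex.ofReal_ofNat] at h5
      refine (Complex.norm_log_one_add_half_le_self h5).trans ?_
      linarith
    have h6 := hz 2 hmem2
    push_cast at h6
    have h7 : (n : ℂ) * (2 * Real.pi * Complex.I) = (Θ - logEuler N (2 + t * Complex.I))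
        - Complex.log (1 + R (2 + t * Complex.I)) := by
      rw [hn, hL]
      simp only
      rw [h6]
      ring
    have h8 : |(n : ℝ)| * (2 * Real.pi) ≤ 3 / 2 * (Real.pi ^ 2 / 6) + 3 / 4 := by
      have : ‖(n : ℂ) * (2 * Real.pi * Complex.I)‖ = |(n : ℝ)| * (2 * Real.pi) := by
        simp [abs_of_pos Real.pi_pos]
      rw [← this, h7]
      exact (norm_sub_le _ _).trans (add_le_add h3 h4)
    have h9 : |(n : ℝ)| < 1 := by
      by_contra h
      have h10 := Real.pi_gt_three
      have h11 := Real.pi_le_four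
      have h12 := not_lt.1 h
      nlinarith
    have h10 : n = 0 := by
      have : |n| < 1 := by exact_mod_cast h9
      exact Int.abs_lt_one_iff.1 this
    rw [hn, h10]
    simp
  rw [logZetaLine, hftc, tsum_tsum_eq_tsum_log, hT]
  rw [Complex.ofReal_ofNat]
  change _ = Complex.log (1 + R (σ + t * Complex.I))
  rw [sub_sub_cancel, ← hz σ hmemσ]
  simp only [hL]
  ring

end

section

open scoped Finset ENNReal

/-- Outside a set of small density, `log ζ` is close to a partial Euler product. -/
theorem exists_exceptional_logEuler {σ : ℝ} (hσ : 1 / 2 < σ) {η : ℝ} (hη : 0 < η) :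
    ∃ N₀ : ℕ, ∀ N ≥ N₀, ∃ T₀ : ℝ, 0 < T₀ ∧ ∀ T ≥ T₀, ∃ Bad : Set ℝ,
      volume Bad ≤ ENNReal.ofReal (η * T) ∧ ∀ t ∈ Set.Icc (-T) T, t ∉ Bad →
        t ∈ OmegaZeta σ ∧ ‖logZetaLine σ t - logEuler N (σ + t * Complex.I)‖ ≤ η := by
  set ε : ℝ := min η 1 / 4 with hε
  have hε0 : 0 < ε := by positivity
  have hεη : ε ≤ η / 4 := by rw [hε]; gcongr; exact min_le_left _ _
  have hε1 : ε ≤ 1 / 4 := by rw [hε]; gcongr; exact min_le_right _ _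
  obtain ⟨N₀, hN₀⟩ := exists_exceptional_errFun hσ hε0
  refine ⟨N₀, fun N hN => ?_⟩
  obtain ⟨T₀, hT₀, h⟩ := hN₀ N hN
  refine ⟨max T₀ (4 * ε⁻¹ / η), lt_max_of_lt_left hT₀, fun T hT => ?_⟩
  obtain ⟨Bad, hBad, hgood⟩ := h T ((le_max_left _ _).trans hT)
  have hT0 : 0 < T := hT₀.trans_le ((le_max_left _ _).trans hT)
  have hT1 : 4 * ε⁻¹ ≤ η * T := by
    have := (le_max_right T₀ _).trans hT
    rw [div_le_iff₀ hη] at this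
    linarith
  refine ⟨Bad ∪ Set.Icc (-ε⁻¹) ε⁻¹, ?_, fun t ht htB => ?_⟩
  · refine (measure_union_le _ _).trans ?_
    rw [Real.volume_Icc]
    refine (add_le_add_left hBad _).trans ?_
    rw [← ENNReal.ofReal_add (by positivity) (by linarith [inv_pos.2 hε0])]
    apply ENNReal.ofReal_le_ofReal
    nlinarith
  · rw [Set.mem_union, not_or] at htB
    have ht1 : ε⁻¹ < |t| := by
      by_contra hc
      exact htB.2 (abs_le.1 (not_lt.1 hc))
    have ht0 : 0 < |t| := (inv_pos.2 hε0).trans ht1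
    have hR : ∀ u ∈ Set.uIcc σ 2, ‖errFun N.factorial (u + t * Complex.I)
        + ((N.factorial.totient / N.factorial : ℝ) : ℂ) / (u + t * Complex.I - 1)‖ ≤ 2 * ε := by
      intro u hu
      refine (norm_add_le _ _).trans ?_
      have h1 := hgood t ht htB.1 u hu
      have h2 : |t| ≤ ‖(u : ℂ) + t * Complex.I - 1‖ := by
        simpa using Complex.abs_im_le_norm ((u : ℂ) + t * Complex.I - 1)
      have h3 : ‖((N.factorial.totient / N.factorial : ℝ) : ℂ) / (u + t * Complex.I - 1)‖ ≤ ε := by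
        rw [norm_div, Complex.norm_of_nonneg (totient_div_nonneg _)]
        rw [div_le_iff₀ (ht0.trans_le h2)]
        refine (totient_div_le_one _).trans ?_
        have : 1 ≤ ε * |t| := by
          rw [inv_lt_iff_one_lt_mul₀ hε0] at ht1
          linarith
        exact this.trans (by gcongr)
      linarith
    obtain ⟨hΩ, hlog⟩ := logZetaLine_sub_logEuler (by linarith) N (abs_pos.1 ht0)
      fun u hu => (hR u hu).trans (by linarith)
    refine ⟨hΩ, ?_⟩
    rw [hlog]
    have h4 := hR σ Set.left_mem_uIcc
    refine (Complex.norm_log_one_add_half_le_self (h4.trans (by linarith))).trans ?_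
    linarith

end

section

/-- The mean value over `[-T, T]`. -/
noncomputable def meanVal (T : ℝ) (f : ℝ → ℂ) : ℂ := ((2 * T : ℝ) : ℂ)⁻¹ * ∫ t in (-T)..T, f t

theorem meanVal_const {T : ℝ} (hT : 0 < T) (c : ℂ) : meanVal T (fun _ => c) = c := by
  rw [meanVal, intervalIntegral.integral_const, sub_neg_eq_add, ← two_mul, Complex.real_smul,
    inv_mul_cancel_left₀]
  exact_mod_cast (by positivity : (2 * T) ≠ 0)

theorem norm_meanVal_le {T : ℝ} (hT : 0 < T) {f : ℝ → ℂ} {C : ℝ} (h : ∀ t, ‖f t‖ ≤ C) :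
    ‖meanVal T f‖ ≤ C := by
  rw [meanVal, norm_mul, norm_inv, Complex.norm_of_nonneg (by positivity)]
  rw [inv_mul_le_iff₀ (by positivity)]
  refine (intervalIntegral.norm_integral_le_of_norm_le_const fun t _ => h t).trans_eq ?_
  rw [sub_neg_eq_add, ← two_mul, abs_of_pos (by positivity), mul_comm]

theorem meanVal_add {f g : ℝ → ℂ} (hf : Continuous f) (hg : Continuous g) (T : ℝ) :
    meanVal T (fun t => f t + g t) = meanVal T f + meanVal T g := by
  rw [meanVal, intervalIntegral.integral_add (hf.intervalIntegrable _ _)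
    (hg.intervalIntegrable _ _), mul_add]; rfl

theorem meanVal_sub {f g : ℝ → ℂ} (hf : Continuous f) (hg : Continuous g) (T : ℝ) :
    meanVal T (fun t => f t - g t) = meanVal T f - meanVal T g := by
  rw [meanVal, intervalIntegral.integral_sub (hf.intervalIntegrable _ _)
    (hg.intervalIntegrable _ _), mul_sub]; rfl

theorem meanVal_const_mul (c : ℂ) (f : ℝ → ℂ) (T : ℝ) :
    meanVal T (fun t => c * f t) = c * meanVal T f := by
  rw [meanVal, intervalIntegral.integral_const_mul, meanVal, mul_left_comm]

theorem tendsto_meanVal_exp {θ : ℝ} (hθ : θ ≠ 0) :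
    Tendsto (fun T => meanVal T fun t => Complex.exp (θ * Complex.I * t)) atTop (nhds 0) := by
  have hc : (θ * Complex.I : ℂ) ≠ 0 := mul_ne_zero (by exact_mod_cast hθ) Complex.I_ne_zero
  have h1 : Tendsto (fun T : ℝ => |θ|⁻¹ * T⁻¹) atTop (nhds 0) := by
    simpa using tendsto_inv_atTop_zero.const_mul (|θ|⁻¹)
  refine squeeze_zero_norm' ?_ h1
  filter_upwards [eventually_gt_atTop 0] with T hT
  have hn : ∀ t : ℝ, ‖Complex.exp (θ * Complex.I * t)‖ = 1 := fun t => by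
    rw [show (θ * Complex.I * t : ℂ) = ((θ * t : ℝ) : ℂ) * Complex.I by push_cast; ring,
      Complex.norm_exp_ofReal_mul_I]
  rw [meanVal, integral_exp_mul_complex hc, norm_mul, norm_inv, norm_div,
    Complex.norm_of_nonneg (by positivity), norm_mul, Complex.norm_I, mul_one, Complex.norm_real,
    Real.norm_eq_abs]
  have h2 := norm_sub_le (Complex.exp (θ * Complex.I * T)) (Complex.exp (θ * Complex.I * (-T : ℝ)))
  rw [hn, hn] at h2
  calc (2 * T)⁻¹ * (_ / |θ|) ≤ (2 * T)⁻¹ * ((1 + 1) / |θ|) := by gcongr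
    _ = _ := by
      have := abs_pos.2 hθ
      field_simp
      norm_num

variable {ι : Type*} [Fintype ι]

/-- The Haar probability measure of the torus. -/
noncomputable def torusHaar (ι : Type*) [Fintype ι] : Measure (UnitAddTorus ι) :=
  Measure.pi fun _ => AddCircle.haarAddCircle

instance : IsProbabilityMeasure (torusHaar ι) := by
  unfold torusHaar; infer_instance

theorem integral_fourier_haar {n : ℤ} (hn : n ≠ 0) :
    ∫ x : UnitAddCircle, fourier n x ∂AddCircle.haarAddCircle = 0 :=
  integral_eq_zero_of_add_right_eq_neg (fourier_add_half_inv_index hn one_pos)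

theorem integral_prod_torusHaar (f : ι → UnitAddCircle → ℂ) :
    ∫ x, ∏ i, f i (x i) ∂torusHaar ι = ∏ i, ∫ x, f i x ∂AddCircle.haarAddCircle :=
  integral_fintype_prod_eq_prod f

theorem integral_mFourier_torusHaar {n : ι → ℤ} (hn : n ≠ 0) :
    ∫ x, UnitAddTorus.mFourier n x ∂torusHaar ι = 0 := by
  obtain ⟨i, hi⟩ := Function.ne_iff.1 hn
  refine (integral_prod_torusHaar fun i x => fourier (n i) x).trans
    (Finset.prod_eq_zero (Finset.mem_univ i) (integral_fourier_haar hi))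

/-- The **Kronecker–Weyl theorem**: a linear flow on the torus with independent frequencies
is equidistributed. -/
theorem tendsto_meanVal_torus {ω : ι → ℝ} (hω : ∀ n : ι → ℤ, ∑ i, n i * ω i = 0 → n = 0)
    (g : C(UnitAddTorus ι, ℂ)) :
    Tendsto (fun T => meanVal T fun t => g fun i => ((t * ω i : ℝ) : UnitAddCircle)) atTop
      (nhds (∫ x, g x ∂torusHaar ι)) := by
  have hflow : Continuous fun (t : ℝ) (i : ι) => ((t * ω i : ℝ) : UnitAddCircle) := by fun_prop
  have hcont : ∀ g : C(UnitAddTorus ι, ℂ),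
      Continuous fun t : ℝ => g fun i => ((t * ω i : ℝ) : UnitAddCircle) := fun g =>
    g.continuous.comp hflow
  have hInt : ∀ g : C(UnitAddTorus ι, ℂ), Integrable g (torusHaar ι) := fun g =>
    g.continuous.integrable_of_hasCompactSupport (HasCompactSupport.of_compactSpace _)
  have hspan : ∀ g ∈ Submodule.span ℂ (Set.range (UnitAddTorus.mFourier (d := ι))),
      Tendsto (fun T => meanVal T fun t => g fun i => ((t * ω i : ℝ) : UnitAddCircle)) atTop
      (nhds (∫ x, g x ∂torusHaar ι)) := by
    intro g hg
    induction hg using Submodule.span_induction with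
    | mem g hg =>
      obtain ⟨n, rfl⟩ := hg
      by_cases hn : n = 0
      · subst hn
        simp only [UnitAddTorus.mFourier_zero, ContinuousMap.one_apply, integral_const,
          probReal_univ, one_smul]
        refine tendsto_const_nhds.congr' ?_
        filter_upwards [eventually_gt_atTop 0] with T hT using (meanVal_const hT 1).symm
      · rw [integral_mFourier_torusHaar hn]
        have hθ : 2 * Real.pi * ∑ i, n i * ω i ≠ 0 :=
          mul_ne_zero (by positivity) fun h => hn (hω n h)
        refine (tendsto_meanVal_exp hθ).congr fun T => ?_
        congr 1
        ext t
        simp only [UnitAddTorus.mFourier, ContinuousMap.coe_mk, fourier_coe_apply,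
          ← Complex.exp_sum]
        congr 1
        push_cast
        rw [Finset.mul_sum, Finset.sum_mul, Finset.sum_mul]
        refine Finset.sum_congr rfl fun i _ => ?_
        ring
    | zero => simp [meanVal]
    | add g h _ _ hg hh =>
      simp only [ContinuousMap.add_apply]
      rw [integral_add (hInt g) (hInt h)]
      refine (hg.add hh).congr fun T => ?_
      rw [meanVal_add (hcont g) (hcont h)]
    | smul c g _ hg =>
      simp only [ContinuousMap.smul_apply, smul_eq_mul, meanVal_const_mul]
      rw [integral_const_mul]
      exact hg.const_mul c
  rw [Metric.tendsto_atTop]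
  intro ε hε
  have hgc : g ∈ closure (Submodule.span ℂ (Set.range (UnitAddTorus.mFourier (d := ι))) :
      Set C(UnitAddTorus ι, ℂ)) := by
    rw [← Submodule.topologicalClosure_coe, UnitAddTorus.span_mFourier_closure_eq_top]
    trivial
  obtain ⟨h, hh, hgh⟩ := Metric.mem_closure_iff.1 hgc (ε / 3) (by positivity)
  obtain ⟨T₀, hT₀⟩ := Metric.tendsto_atTop.1 (hspan h hh) (ε / 3) (by positivity)
  refine ⟨max T₀ 1, fun T hT => ?_⟩
  have hT1 : 0 < T := one_pos.trans_le ((le_max_right _ _).trans hT)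
  have hle : ∀ x, ‖g x - h x‖ ≤ ε / 3 := fun x => by
    rw [← dist_eq_norm]
    exact (ContinuousMap.dist_apply_le_dist x).trans hgh.le
  have h1 := norm_meanVal_le hT1 (f := fun t => g (fun i => ((t * ω i : ℝ) : UnitAddCircle))
    - h fun i => ((t * ω i : ℝ) : UnitAddCircle)) fun t => hle _
  rw [meanVal_sub (hcont g) (hcont h), ← dist_eq_norm] at h1
  have h2 := hT₀ T ((le_max_left _ _).trans hT)
  have h3 : dist (∫ x, h x ∂torusHaar ι) (∫ x, g x ∂torusHaar ι) ≤ ε / 3 := by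
    rw [dist_comm, dist_eq_norm, ← integral_sub (hInt g) (hInt h)]
    refine (norm_integral_le_of_norm_le_const (ae_of_all _ hle)).trans_eq ?_
    simp
  have h4 := dist_triangle4 (meanVal T fun t => g fun i => ((t * ω i : ℝ) : UnitAddCircle))
    (meanVal T fun t => h fun i => ((t * ω i : ℝ) : UnitAddCircle))
    (∫ x, h x ∂torusHaar ι) (∫ x, g x ∂torusHaar ι)
  linarith

end

section

theorem prime_log_independent {S : Finset ℕ} (hS : ∀ p ∈ S, p.Prime) (n : S → ℤ)
    (h : ∑ p, n p * Real.log (p : ℕ) = 0) : n = 0 := by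
  have hpos : ∀ p : S, (0 : ℝ) < (p : ℕ) := fun p => by exact_mod_cast (hS p p.2).pos
  have h1 : ∏ p : S, ((p : ℕ) : ℝ) ^ n p = 1 := by
    apply Real.log_injOn_pos (Set.mem_Ioi.2 (Finset.prod_pos fun p _ => zpow_pos (hpos p) _))
      (Set.mem_Ioi.2 one_pos)
    rw [Real.log_prod fun p _ => (zpow_pos (hpos p) _).ne', Real.log_one, ← h]
    exact Finset.sum_congr rfl fun p _ => Real.log_zpow _ _
  have h2 : ∏ p : S, ((p : ℕ) : ℚ) ^ n p = 1 := by
    apply Rat.cast_injective (α := ℝ)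
    simpa only [Rat.cast_prod, Rat.cast_zpow, Rat.cast_natCast, Rat.cast_one] using h1
  ext q
  have : Fact (q : ℕ).Prime := ⟨hS q q.2⟩
  have h3 : ∏ p : S, ((p : ℕ) : ℚ_[(q : ℕ)]) ^ n p = 1 := by
    simpa only [Rat.cast_prod, Rat.cast_zpow, Rat.cast_natCast, Rat.cast_one] using
      congrArg (Rat.cast : ℚ → ℚ_[(q : ℕ)]) h2
  have h4 := congrArg norm h3
  rw [norm_prod, norm_one, Finset.prod_eq_single q] at h4
  · rw [norm_zpow, Padic.norm_p, inv_zpow, inv_eq_one] at h4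
    exact (zpow_eq_one_iff_right₀ (by positivity) (by exact_mod_cast this.out.ne_one)).1 h4
  · intro p _ hpq
    rw [norm_zpow, Padic.norm_natCast_eq_one_iff.2, one_zpow]
    exact (Nat.coprime_primes this.out (hS p p.2)).2 fun h => hpq (Subtype.ext h.symm)
  · exact fun h => (h (Finset.mem_univ _)).elim

/-- The characteristic function of `-log (1 - r ξ)`, where `ξ` is uniform on the unit circle. -/
noncomputable def circleChar (r : ℝ) (w : ℂ) : ℂ :=
  ∫ x : UnitAddCircle, Complex.exp
    ((inner ℝ (-Complex.log (1 - r * fourier 1 x)) w : ℝ) * Complex.I) ∂AddCircle.haarAddCircle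

theorem norm_mul_fourier {r : ℝ} (hr : 0 ≤ r) (x : UnitAddCircle) :
    ‖(r * fourier 1 x : ℂ)‖ = r := by
  rw [norm_mul, Complex.norm_of_nonneg hr, fourier_one, Circle.norm_coe, mul_one]

theorem continuous_neg_log_one_sub_mul_fourier {r : ℝ} (hr : 0 ≤ r) (hr1 : r < 1) :
    Continuous fun x : UnitAddCircle => -Complex.log (1 - r * fourier 1 x) := by
  refine (Continuous.clog (by fun_prop) fun x => ?_).neg
  rw [sub_eq_add_neg]
  exact Complex.mem_slitPlane_of_norm_lt_one (by rwa [norm_neg, norm_mul_fourier hr])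

theorem continuous_exp_inner {X : Type*} [TopologicalSpace X] {f : X → ℂ} (hf : Continuous f)
    (w : ℂ) : Continuous fun x => Complex.exp ((inner ℝ (f x) w : ℝ) * Complex.I) :=
  ((Complex.continuous_ofReal.comp (hf.inner continuous_const)).mul continuous_const).cexp

theorem prime_cpow_eq_mul_fourier {p : ℕ} (hp : p.Prime) (σ t : ℝ) :
    (p : ℂ) ^ (-(σ + t * Complex.I)) = ((p : ℝ) ^ (-σ) : ℝ)
      * fourier 1 ((t * (-Real.log p / (2 * Real.pi)) : ℝ) : UnitAddCircle) := by
  have h0 : (p : ℂ) ≠ 0 := by exact_mod_cast hp.ne_zero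
  have h1 : (0 : ℝ) < p := by exact_mod_cast hp.pos
  rw [fourier_coe_apply, neg_add, Complex.cpow_add _ _ h0, Complex.ofReal_cpow h1.le,
    Complex.ofReal_natCast, Complex.ofReal_neg]
  congr 1
  rw [Complex.cpow_def_of_ne_zero h0, ← Complex.ofReal_natCast, ← Complex.ofReal_log h1.le]
  congr 1
  have := Real.pi_ne_zero
  push_cast
  field_simp

/-- The partial Euler products have asymptotic distributions with product structure. -/
theorem tendsto_meanVal_logEuler {σ : ℝ} (hσ : 0 < σ) (N : ℕ) (w : ℂ) :
    Tendsto (fun T => meanVal T fun t => Complex.exp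
      ((inner ℝ (logEuler N (σ + t * Complex.I)) w : ℝ) * Complex.I)) atTop
      (nhds (∏ p ∈ N.factorial.primeFactors, circleChar ((p : ℝ) ^ (-σ)) w)) := by
  set S := N.factorial.primeFactors
  have hS : ∀ p ∈ S, p.Prime := fun p hp => Nat.prime_of_mem_primeFactors hp
  set r : ℕ → ℝ := fun p => (p : ℝ) ^ (-σ)
  have hr0 : ∀ p, 0 ≤ r p := fun p => by positivity
  have hr1 : ∀ p ∈ S, r p < 1 := fun p hp => Real.rpow_lt_one_of_one_lt_of_neg
    (by exact_mod_cast (hS p hp).one_lt) (by linarith)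
  let G : S → UnitAddCircle → ℂ := fun p x => Complex.exp
    ((inner ℝ (-Complex.log (1 - r p * fourier 1 x)) w : ℝ) * Complex.I)
  have hG : ∀ p, Continuous (G p) := fun p => continuous_exp_inner
    (continuous_neg_log_one_sub_mul_fourier (hr0 p) (hr1 p p.2)) w
  let g : C(UnitAddTorus S, ℂ) := ⟨fun x => ∏ p, G p (x p),
    continuous_finsetProd _ fun p _ => (hG p).comp (continuous_apply p)⟩
  have hind : ∀ n : S → ℤ, ∑ p, n p * (-Real.log (p : ℕ) / (2 * Real.pi)) = 0 → n = 0 := by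
    intro n h
    apply prime_log_independent hS n
    have : ∑ p, n p * (-Real.log (p : ℕ) / (2 * Real.pi))
        = -(2 * Real.pi)⁻¹ * ∑ p, n p * Real.log (p : ℕ) := by
      rw [Finset.mul_sum]
      exact Finset.sum_congr rfl fun p _ => by ring
    rw [this] at h
    exact (mul_eq_zero.1 h).resolve_left (by simp [Real.pi_ne_zero])
  have h := tendsto_meanVal_torus hind g
  have hI : ∫ x, g x ∂torusHaar S = ∏ p ∈ S, circleChar (r p) w := by
    rw [← Finset.prod_coe_sort]
    exact integral_prod_torusHaar G
  rw [hI] at h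
  refine h.congr fun T => ?_
  congr 1
  ext t
  change ∏ p : S, Complex.exp _ = _
  rw [← Complex.exp_sum, ← Finset.sum_mul, ← Complex.ofReal_sum, ← sum_inner]
  congr 4
  rw [logEuler]
  refine Eq.trans ?_ (Finset.sum_coe_sort _ _)
  refine Finset.sum_congr rfl fun p _ => ?_
  rw [prime_cpow_eq_mul_fourier (hS p p.2)]

end

section

theorem norm_exp_ofReal_I_le (a : ℝ) : ‖Complex.exp ((a : ℝ) * Complex.I)‖ ≤ 1 :=
  (Complex.norm_exp_ofReal_mul_I a).le

theorem norm_circleChar_le_one (r : ℝ) (w : ℂ) : ‖circleChar r w‖ ≤ 1 := by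
  refine (norm_integral_le_of_norm_le_const (ae_of_all _ fun x => norm_exp_ofReal_I_le _)).trans ?_
  simp

theorem integral_inner_fourier {n : ℤ} (hn : n ≠ 0) (w : ℂ) :
    ∫ x : UnitAddCircle, (inner ℝ (fourier n x : ℂ) w : ℝ) ∂AddCircle.haarAddCircle = 0 := by
  simp_rw [real_inner_comm w]
  have hi : Integrable (fun x : UnitAddCircle => (fourier n x : ℂ)) AddCircle.haarAddCircle :=
    (map_continuous _).integrable_of_hasCompactSupport (HasCompactSupport.of_compactSpace _)
  have h := integral_inner (𝕜 := ℝ) hi w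
  rw [h, integral_fourier_haar hn, inner_zero_right]

theorem inner_fourier_one_sq (x : UnitAddCircle) (w : ℂ) :
    (inner ℝ (fourier 1 x : ℂ) w : ℝ) ^ 2
      = ‖w‖ ^ 2 / 2 + (inner ℝ (fourier 2 x : ℂ) (w ^ 2) : ℝ) / 2 := by
  have h2 : (fourier 2 x : ℂ) = fourier 1 x * fourier 1 x := by
    rw [← fourier_add]; norm_num
  have h1 : ‖(fourier 1 x : ℂ)‖ ^ 2 = 1 := by rw [fourier_one, Circle.norm_coe, one_pow]
  rw [h2]
  rw [← Complex.normSq_eq_norm_sq, Complex.normSq_apply] at h1 ⊢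
  simp only [Complex.inner, Complex.mul_re, Complex.conj_re, Complex.conj_im, Complex.mul_im, sq]
  set u := (fourier 1 x : ℂ).re
  set v := (fourier 1 x : ℂ).im
  linear_combination (w.re * w.re + w.im * w.im) / 2 * h1

theorem norm_circleChar_le {r : ℝ} (hr : 0 ≤ r) {w : ℂ} (hw : 16 ≤ ‖w‖) (hrw : r * ‖w‖ ≤ 1 / 4) :
    ‖circleChar r w‖ ≤ 1 - r ^ 2 * ‖w‖ ^ 2 / 8 := by
  have hr2 : r ≤ 1 / 2 := by nlinarith
  set b : UnitAddCircle → ℝ := fun x => r * inner ℝ (fourier 1 x : ℂ) w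
  have hbc : Continuous b := continuous_const.mul ((map_continuous _).inner continuous_const)
  have hb : ∀ x, |b x| ≤ r * ‖w‖ := fun x => by
    have := abs_real_inner_le_norm (fourier 1 x : ℂ) w
    rw [fourier_one, Circle.norm_coe, one_mul] at this
    rw [abs_mul, abs_of_nonneg hr, fourier_one]
    gcongr
  set q : UnitAddCircle → ℂ := fun x => ((1 - b x ^ 2 / 2 : ℝ) : ℂ) + (b x : ℝ) * Complex.I
  have hqc : Continuous q := by fun_prop
  have hInt : ∀ {E : Type} [NormedAddCommGroup E] {f : UnitAddCircle → E}, Continuous f →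
      Integrable f AddCircle.haarAddCircle := fun hf =>
    hf.integrable_of_hasCompactSupport (HasCompactSupport.of_compactSpace _)
  have hbi : ∫ x, b x ∂AddCircle.haarAddCircle = 0 := by
    rw [integral_const_mul, integral_inner_fourier one_ne_zero, mul_zero]
  have hb2i : ∫ x, (1 - b x ^ 2 / 2) ∂AddCircle.haarAddCircle = 1 - r ^ 2 * ‖w‖ ^ 2 / 4 := by
    have : ∀ x, 1 - b x ^ 2 / 2 = (1 - r ^ 2 * ‖w‖ ^ 2 / 4)
        - r ^ 2 / 4 * inner ℝ (fourier 2 x : ℂ) (w ^ 2) := fun x => by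
      simp only [b]
      rw [mul_pow, inner_fourier_one_sq]
      ring
    simp_rw [this]
    have hc : Continuous fun x : UnitAddCircle =>
        r ^ 2 / 4 * (inner ℝ (fourier 2 x : ℂ) (w ^ 2) : ℝ) :=
      continuous_const.mul ((map_continuous _).inner continuous_const)
    rw [integral_sub (integrable_const _) (hInt hc), integral_const_mul,
      integral_inner_fourier two_ne_zero, integral_const, probReal_univ]
    simp
  have hqi : ∫ x, q x ∂AddCircle.haarAddCircle = ((1 - r ^ 2 * ‖w‖ ^ 2 / 4 : ℝ) : ℂ) := by
    rw [integral_add (hInt (by fun_prop)) (hInt (by fun_prop)), integral_mul_const,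
      integral_complex_ofReal, integral_complex_ofReal, hbi, hb2i]
    simp
  have hdiff : ∀ x, ‖Complex.exp
      ((inner ℝ (-Complex.log (1 - r * fourier 1 x)) w : ℝ) * Complex.I) - q x‖
      ≤ r ^ 2 * ‖w‖ + 2 / 9 * (r * ‖w‖) ^ 3 := by
    intro x
    set z : ℂ := r * fourier 1 x
    have hz : ‖z‖ = r := norm_mul_fourier hr x
    have hbz : b x = inner ℝ z w := by
      simp only [b, z]
      rw [← Complex.real_smul, real_inner_smul_left]
    have h1 : ‖-Complex.log (1 - z) - z‖ ≤ r ^ 2 := by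
      have h := Complex.norm_log_one_add_sub_self_le (z := -z) (by rw [norm_neg, hz]; linarith)
      rw [norm_neg, hz] at h
      have e : -Complex.log (1 - z) - z = -(Complex.log (1 + -z) - -z) := by
        rw [← sub_eq_add_neg]; ring
      rw [e, norm_neg]
      refine h.trans ?_
      have : (1 - r)⁻¹ ≤ 2 := by
        rw [inv_le_comm₀ (by linarith) two_pos]; linarith
      nlinarith [sq_nonneg r]
    have h2 : ‖Complex.exp ((inner ℝ (-Complex.log (1 - z)) w : ℝ) * Complex.I)
        - Complex.exp ((b x : ℝ) * Complex.I)‖ ≤ r ^ 2 * ‖w‖ := by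
      have e : Complex.exp ((inner ℝ (-Complex.log (1 - z)) w : ℝ) * Complex.I)
          - Complex.exp ((b x : ℝ) * Complex.I) = Complex.exp ((b x : ℝ) * Complex.I) *
          (Complex.exp (Complex.I * ((inner ℝ (-Complex.log (1 - z) - z) w : ℝ))) - 1) := by
        rw [mul_sub, ← Complex.exp_add, mul_one, inner_sub_left, ← hbz]
        congr 2
        push_cast
        ring
      rw [e, norm_mul, Complex.norm_exp_ofReal_mul_I, one_mul]
      refine (Real.norm_exp_I_mul_ofReal_sub_one_le).trans ?_
      rw [Real.norm_eq_abs]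
      exact (abs_real_inner_le_norm _ _).trans (by gcongr)
    have h3 : ‖Complex.exp ((b x : ℝ) * Complex.I) - q x‖ ≤ 2 / 9 * (r * ‖w‖) ^ 3 := by
      have hn : ‖((b x : ℝ) * Complex.I : ℂ)‖ = |b x| := by simp
      have h := Complex.exp_bound (x := (b x : ℝ) * Complex.I)
        (by rw [hn]; exact (hb x).trans (by linarith)) (n := 3) (by norm_num)
      rw [hn] at h
      have e : ∑ m ∈ Finset.range 3, ((b x : ℝ) * Complex.I : ℂ) ^ m / (m.factorial : ℂ) = q x := by
        simp only [Finset.sum_range_succ, Finset.sum_range_zero, q, mul_pow, Complex.I_sq]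
        simp
        ring
      rw [e] at h
      refine h.trans ?_
      have : |b x| ^ 3 ≤ (r * ‖w‖) ^ 3 := by gcongr; exact hb x
      norm_num [Nat.factorial]
      linarith
    calc _ = ‖(Complex.exp ((inner ℝ (-Complex.log (1 - z)) w : ℝ) * Complex.I)
        - Complex.exp ((b x : ℝ) * Complex.I)) + (Complex.exp ((b x : ℝ) * Complex.I) - q x)‖ := by
          rw [sub_add_sub_cancel]
      _ ≤ _ := (norm_add_le _ _).trans (add_le_add h2 h3)
  have hei := hInt (continuous_exp_inner
    (continuous_neg_log_one_sub_mul_fourier hr (by linarith)) w)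
  have hmain : ‖circleChar r w - ((1 - r ^ 2 * ‖w‖ ^ 2 / 4 : ℝ) : ℂ)‖
      ≤ r ^ 2 * ‖w‖ + 2 / 9 * (r * ‖w‖) ^ 3 := by
    rw [← hqi, circleChar, ← integral_sub hei (hInt hqc)]
    refine (norm_integral_le_of_norm_le_const (ae_of_all _ hdiff)).trans ?_
    simp
  have h4 := norm_le_norm_add_norm_sub' (circleChar r w) ((1 - r ^ 2 * ‖w‖ ^ 2 / 4 : ℝ) : ℂ)
  have h0 : 0 ≤ r * ‖w‖ := by positivity
  rw [Complex.norm_of_nonneg (by nlinarith)] at h4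
  refine (h4.trans (by gcongr)).trans ?_
  have h5 : (r * ‖w‖) ^ 3 ≤ 1 / 4 * (r * ‖w‖) ^ 2 := by nlinarith [sq_nonneg (r * ‖w‖)]
  have h6 : r ^ 2 * ‖w‖ ≤ 1 / 16 * (r * ‖w‖) ^ 2 := by
    nlinarith [sq_nonneg r, mul_nonneg (sq_nonneg r) (norm_nonneg w)]
  nlinarith [sq_nonneg (r * ‖w‖)]

end

section

theorem eventually_rpow_le_primeCounting {a : ℝ} (ha : a < 1) :
    ∀ᶠ z : ℝ in atTop, 3 * z ^ a ≤ Nat.primeCounting ⌊z⌋₊ := by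
  have h1 := (isLittleO_log_rpow_atTop (sub_pos.2 ha)).bound (show (0 : ℝ) < 1 / 12 by norm_num)
  have h2 := (Real.isLittleO_log_id_atTop).bound (show (0 : ℝ) < 1 / 16 by norm_num)
  filter_upwards [h1, h2, eventually_ge_atTop 64] with z h1 h2 hz
  have hz0 : 0 < z := by linarith
  have hL : 0 < Real.log z := Real.log_pos (by linarith)
  rw [Real.norm_of_nonneg hL.le, Real.norm_of_nonneg (by positivity)] at h1
  rw [Real.norm_of_nonneg hL.le, id, Real.norm_of_nonneg hz0.le] at h2
  set n := ⌊z⌋₊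
  have hn : (n : ℝ) ≤ z := Nat.floor_le hz0.le
  have hn1 : z < n + 1 := Nat.lt_floor_add_one z
  have hlogn : 0 < Real.log n := Real.log_pos (by linarith)
  have hlogn1 : Real.log n ≤ Real.log z := Real.log_le_log (by linarith) hn
  have hlogn2 : Real.log (n + 1) ≤ Real.log z + 1 := by
    calc Real.log (n + 1) ≤ Real.log (z * 2) := Real.log_le_log (by linarith) (by linarith)
      _ ≤ _ := by
        rw [Real.log_mul hz0.ne' two_ne_zero]
        linarith [Real.log_two_lt_d9]
  have h3 := Chebyshev.pi_ge n
  have h4 : z / 4 ≤ n * Real.log 2 - Real.log (n + 1) := by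
    have := Real.log_two_gt_d9
    have : (n : ℝ) * (1 / 2) ≤ n * Real.log 2 := by gcongr; linarith
    linarith
  calc 3 * z ^ a ≤ z / 4 / Real.log z := by
        rw [le_div_iff₀ hL]
        calc 3 * z ^ a * Real.log z ≤ 3 * z ^ a * (1 / 12 * z ^ (1 - a)) := by gcongr
          _ = 1 / 4 * (z ^ a * z ^ (1 - a)) := by ring
          _ = z / 4 := by rw [← Real.rpow_add hz0]; simp; ring
    _ ≤ (n * Real.log 2 - Real.log (n + 1)) / Real.log n := by
        gcongr
        linarith
    _ ≤ _ := h3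

/-- The characteristic function of the asymptotic distribution of `logEuler N (σ + it)`. -/
noncomputable def eulerChar (σ : ℝ) (N : ℕ) (w : ℂ) : ℂ :=
  ∏ p ∈ N.factorial.primeFactors, circleChar ((p : ℝ) ^ (-σ)) w

theorem norm_eulerChar_le_one (σ : ℝ) (N : ℕ) (w : ℂ) : ‖eulerChar σ N w‖ ≤ 1 := by
  rw [eulerChar, norm_prod]
  exact Finset.prod_le_one (fun _ _ => norm_nonneg _) fun _ _ => norm_circleChar_le_one _ _

theorem norm_eulerChar_le_exp {σ : ℝ} (hσ : 0 < σ) : ∃ Y : ℝ, 1 ≤ Y ∧ ∀ y ≥ Y, ∃ N₁ : ℕ, ∀ N ≥ N₁,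
    ∀ w : ℂ, ‖w‖ = y ^ σ / 4 → ‖eulerChar σ N w‖ ≤ Real.exp (-(y ^ (1 / 2 : ℝ) / 128)) := by
  set ε : ℝ := 1 / (4 * σ) with hε
  have hε0 : 0 < ε := by positivity
  have h1 : ∀ᶠ y : ℝ in atTop, 3 * y ≤ Nat.primeCounting ⌊y ^ (1 + ε)⌋₊ := by
    have h := (tendsto_rpow_atTop (show 0 < 1 + ε by linarith)).eventually
      (eventually_rpow_le_primeCounting (a := (1 + ε)⁻¹) (inv_lt_one_of_one_lt₀ (by linarith)))
    filter_upwards [h, eventually_ge_atTop 0] with y hy hy0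
    rwa [← Real.rpow_mul hy0, mul_inv_cancel₀ (by linarith), Real.rpow_one] at hy
  have h2 : ∀ᶠ y : ℝ in atTop, 64 ≤ y ^ σ := (tendsto_rpow_atTop hσ).eventually_ge_atTop 64
  obtain ⟨Y, hY⟩ := eventually_atTop.1 (h1.and h2)
  refine ⟨max Y 1, le_max_right _ _, fun y hy => ?_⟩
  obtain ⟨hpi, h64⟩ := hY y ((le_max_left _ _).trans hy)
  have hy1 : 1 ≤ y := (le_max_right _ _).trans hy
  have hy0 : 0 < y := by linarith
  set z := y ^ (1 + ε) with hz
  have hz0 : 0 < z := by positivity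
  refine ⟨⌊z⌋₊, fun N hN w hw => ?_⟩
  set A : Finset ℕ := Nat.primesLE ⌊z⌋₊ \ Finset.range (⌊y⌋₊ + 1) with hA
  have hcard : y ≤ A.card := by
    have h := Finset.le_card_sdiff (Finset.range (⌊y⌋₊ + 1)) (Nat.primesLE ⌊z⌋₊)
    rw [Finset.card_range, Nat.primesLE_card_eq_primeCounting, ← hA, Nat.sub_le_iff_le_add] at h
    have h' : (Nat.primeCounting ⌊z⌋₊ : ℝ) ≤ A.card + (⌊y⌋₊ + 1) := by exact_mod_cast h
    have := Nat.floor_le hy0.le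
    linarith
  have hmem : ∀ p ∈ A, p.Prime ∧ y < p ∧ (p : ℝ) ≤ z := by
    intro p hp
    rw [hA, Finset.mem_sdiff, Nat.mem_primesLE, Finset.mem_range, not_lt] at hp
    refine ⟨hp.1.2, (Nat.lt_floor_add_one y).trans_le (by exact_mod_cast hp.2), ?_⟩
    exact (Nat.cast_le.2 hp.1.1).trans (Nat.floor_le hz0.le)
  have hsub : A ⊆ N.factorial.primeFactors := by
    intro p hp
    obtain ⟨h1, h2, h3⟩ := hmem p hp
    refine Nat.mem_primeFactors.2 ⟨h1, (Nat.Prime.dvd_factorial h1).2 ?_, N.factorial_ne_zero⟩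
    exact (Nat.le_floor h3).trans hN
  have hfac : ∀ p ∈ A, ‖circleChar ((p : ℝ) ^ (-σ)) w‖
      ≤ Real.exp (-(y ^ (-(1 / 2) : ℝ) / 128)) := by
    intro p hp
    obtain ⟨h1, h2, h3⟩ := hmem p hp
    have hp0 : (0 : ℝ) < p := hy0.trans h2
    have hr1 : (p : ℝ) ^ (-σ) ≤ y ^ (-σ) :=
      Real.rpow_le_rpow_of_nonpos hy0 h2.le (by linarith)
    have hr2 : z ^ (-σ) ≤ (p : ℝ) ^ (-σ) :=
      Real.rpow_le_rpow_of_nonpos hp0 h3 (by linarith)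
    have hyy : y ^ (-σ) * y ^ σ = 1 := by rw [← Real.rpow_add hy0]; simp
    refine (norm_circleChar_le (by positivity) (by rw [hw]; linarith) ?_).trans ?_
    · rw [hw]
      calc (p : ℝ) ^ (-σ) * (y ^ σ / 4) ≤ y ^ (-σ) * (y ^ σ / 4) := by gcongr
        _ = 1 / 4 := by rw [← mul_div_assoc, hyy]
    · refine (Real.one_sub_le_exp_neg _).trans (Real.exp_le_exp.2 (neg_le_neg ?_))
      rw [hw]
      have e : y ^ (-(1 / 2) : ℝ) = (z ^ (-σ)) ^ 2 * (y ^ σ) ^ 2 := by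
        rw [hz, ← Real.rpow_natCast, ← Real.rpow_natCast (y ^ σ), ← Real.rpow_mul hy0.le,
          ← Real.rpow_mul hy0.le, ← Real.rpow_mul hy0.le, ← Real.rpow_add hy0]
        congr 1
        rw [hε]
        push_cast
        field_simp
        ring
      rw [e]
      have : (z ^ (-σ)) ^ 2 ≤ ((p : ℝ) ^ (-σ)) ^ 2 := by gcongr
      have := mul_le_mul_of_nonneg_right this (sq_nonneg (y ^ σ))
      linarith [div_pow (y ^ σ) 4 2]
  rw [eulerChar, norm_prod, ← Finset.prod_sdiff hsub]
  calc _ ≤ 1 * Real.exp (-(y ^ (-(1 / 2) : ℝ) / 128)) ^ A.card := by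
        refine mul_le_mul
          (Finset.prod_le_one (fun _ _ => norm_nonneg _) fun _ _ => norm_circleChar_le_one _ _)
          ?_ (Finset.prod_nonneg fun _ _ => norm_nonneg _) zero_le_one
        refine (Finset.prod_le_prod (fun _ _ => norm_nonneg _) hfac).trans_eq ?_
        rw [Finset.prod_const]
    _ ≤ _ := by
        rw [one_mul, ← Real.exp_nat_mul]
        apply Real.exp_le_exp.2
        have e : y ^ (1 / 2 : ℝ) = y * y ^ (-(1 / 2) : ℝ) := by
          nth_rewrite 2 [← Real.rpow_one y]
          rw [← Real.rpow_add hy0]; norm_num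
        rw [e]
        have := mul_le_mul_of_nonneg_right hcard (show 0 ≤ y ^ (-(1 / 2) : ℝ) by positivity)
        linarith

/-- Decay of the characteristic functions, uniform in the number of primes. -/
theorem norm_eulerChar_le {σ : ℝ} (hσ : 0 < σ) : ∃ C : ℝ, 0 < C ∧ ∀ w : ℂ, ∀ᶠ N in atTop,
    ‖eulerChar σ N w‖ ≤ C * (1 + ‖w‖) ^ (-3 : ℝ) := by
  obtain ⟨Y, hY1, hY⟩ := norm_eulerChar_le_exp hσ
  have h1 := ((isLittleO_exp_neg_mul_rpow_atTop (show (0 : ℝ) < 1 / 128 by norm_num)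
    (-(6 * σ))).comp_tendsto
      (tendsto_rpow_atTop (show (0 : ℝ) < 1 / 2 by norm_num))).bound (one_pos)
  obtain ⟨Y', hY'⟩ := eventually_atTop.1 h1
  set Z := max (max Y Y') (4 ^ (1 / σ))
  have hZY : Y ≤ Z := (le_max_left _ _).trans (le_max_left _ _)
  have hZY' : Y' ≤ Z := (le_max_right _ _).trans (le_max_left _ _)
  have hZ4 : (4 : ℝ) ^ (1 / σ) ≤ Z := le_max_right _ _
  have hZ0 : 0 < Z := by linarith
  refine ⟨max ((1 + Z ^ σ / 4) ^ 3) 1, by positivity, fun w => ?_⟩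
  have hpow : (1 + ‖w‖) ^ (-3 : ℝ) = ((1 + ‖w‖) ^ 3)⁻¹ := by
    rw [Real.rpow_neg (by positivity)]; norm_cast
  rw [hpow]
  by_cases hw : ‖w‖ ≤ Z ^ σ / 4
  · refine Eventually.of_forall fun N => (norm_eulerChar_le_one σ N w).trans ?_
    rw [← div_eq_mul_inv, one_le_div (by positivity)]
    exact le_trans (by gcongr) (le_max_left _ _)
  · rw [not_le] at hw
    set y := (4 * ‖w‖) ^ (1 / σ) with hy
    have hyσ : y ^ σ = 4 * ‖w‖ := by
      rw [hy, ← Real.rpow_mul (by positivity), one_div_mul_cancel hσ.ne', Real.rpow_one]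
    have hy0 : 0 ≤ y := by positivity
    have hZy : Z ≤ y := by
      rw [← Real.rpow_le_rpow_iff hZ0.le hy0 hσ, hyσ]
      linarith
    have hw1 : 1 ≤ ‖w‖ := by
      have : (4 : ℝ) ≤ Z ^ σ := by
        calc (4 : ℝ) = (4 ^ (1 / σ)) ^ σ := by
              rw [← Real.rpow_mul (by norm_num), one_div_mul_cancel hσ.ne', Real.rpow_one]
          _ ≤ _ := by gcongr
      linarith
    obtain ⟨N₁, hN₁⟩ := hY y (hZY.trans hZy)
    filter_upwards [eventually_ge_atTop N₁] with N hN
    refine (hN₁ N hN w (by rw [hyσ]; ring)).trans ?_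
    have h2 := hY' y (hZY'.trans hZy)
    simp only [Function.comp_apply, one_mul] at h2
    rw [Real.norm_of_nonneg (by positivity), Real.norm_of_nonneg (by positivity)] at h2
    have e1 : (y ^ (1 / 2 : ℝ)) ^ (-(6 * σ)) = ((4 * ‖w‖) ^ 3)⁻¹ := by
      rw [← hyσ, ← Real.rpow_natCast, ← Real.rpow_mul hy0, ← Real.rpow_mul hy0,
        ← Real.rpow_neg hy0]
      congr 1
      push_cast
      ring
    rw [e1] at h2
    calc Real.exp (-(y ^ (1 / 2 : ℝ) / 128)) = Real.exp (-(1 / 128) * y ^ (1 / 2 : ℝ)) := by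
          congr 1; ring
      _ ≤ ((4 * ‖w‖) ^ 3)⁻¹ := h2
      _ ≤ 1 * ((1 + ‖w‖) ^ 3)⁻¹ := by
          rw [one_mul]
          gcongr
          linarith
      _ ≤ _ := by
          gcongr
          exact le_max_right _ _

end

section

theorem norm_meanVal_le_of_exceptional {T η δ K : ℝ} (hT : 0 < T) (hη : 0 ≤ η) (hδ : 0 ≤ δ)
    {h : ℝ → ℂ} (hK : ∀ t, ‖h t‖ ≤ K) {Bad : Set ℝ}
    (hBad : volume Bad ≤ ENNReal.ofReal (η * T))
    (hgood : ∀ t ∈ Set.Icc (-T) T, t ∉ Bad → ‖h t‖ ≤ δ) :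
    ‖meanVal T h‖ ≤ δ + K * η / 2 := by
  set B := toMeasurable volume Bad
  have hB : MeasurableSet B := measurableSet_toMeasurable _ _
  have hK0 : 0 ≤ K := (norm_nonneg _).trans (hK 0)
  have hBv : volume.real B ≤ η * T := by
    refine ENNReal.toReal_le_of_le_ofReal (by positivity) ?_
    rwa [measure_toMeasurable]
  have hBfin : volume B ≠ ⊤ := by
    rw [measure_toMeasurable]; exact ne_top_of_le_ne_top ENNReal.ofReal_ne_top hBad
  have hi₁ : IntegrableOn (fun _ : ℝ => δ) (Set.Ioc (-T) T) := integrableOn_const (by simp)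
  have hi₂ : IntegrableOn (B.indicator fun _ => K) (Set.Ioc (-T) T) :=
    ((integrable_indicator_iff hB).2 (integrableOn_const hBfin)).integrableOn
  have hi : IntegrableOn (fun t : ℝ => δ + B.indicator (fun _ => K) t) (Set.Ioc (-T) T) :=
    hi₁.add hi₂
  have h1 : ‖∫ t in (-T)..T, h t‖ ≤ ∫ t in Set.Ioc (-T) T, (δ + B.indicator (fun _ => K) t) := by
    rw [intervalIntegral.integral_of_le (by linarith)]
    refine norm_integral_le_of_norm_le hi ?_
    refine (ae_restrict_iff' measurableSet_Ioc).2 (ae_of_all _ fun t ht => ?_)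
    by_cases htB : t ∈ B
    · rw [Set.indicator_of_mem htB]
      exact (hK t).trans (by linarith)
    · rw [Set.indicator_of_notMem htB, add_zero]
      exact hgood t (Set.Ioc_subset_Icc_self ht) fun h => htB (subset_toMeasurable _ _ h)
  have h2 : ∫ t in Set.Ioc (-T) T, (δ + B.indicator (fun _ => K) t) ≤ δ * (2 * T) + K * (η * T) := by
    rw [integral_add hi₁ hi₂]
    refine add_le_add ?_ ?_
    · rw [setIntegral_const, Real.volume_real_Ioc_of_le (by linarith), smul_eq_mul]
      apply le_of_eq; ring
    · rw [integral_indicator hB, setIntegral_const, smul_eq_mul, mul_comm]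
      gcongr
      refine le_trans ?_ hBv
      exact ENNReal.toReal_mono hBfin (Measure.restrict_apply_le _ _)
  rw [meanVal, norm_mul, norm_inv, Complex.norm_of_nonneg (by positivity),
    inv_mul_le_iff₀ (by positivity)]
  refine (h1.trans h2).trans_eq ?_
  ring

theorem norm_exp_I_sub_exp_I_le (a b : ℝ) :
    ‖Complex.exp ((a : ℝ) * Complex.I) - Complex.exp ((b : ℝ) * Complex.I)‖ ≤ |a - b| := by
  have e : Complex.exp ((a : ℝ) * Complex.I) - Complex.exp ((b : ℝ) * Complex.I)
      = Complex.exp ((b : ℝ) * Complex.I) * (Complex.exp (Complex.I * ((a - b : ℝ) : ℂ)) - 1) := by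
    rw [mul_sub, ← Complex.exp_add, mul_one]
    congr 2
    push_cast
    ring
  rw [e, norm_mul, Complex.norm_exp_ofReal_mul_I, one_mul]
  exact Real.norm_exp_I_mul_ofReal_sub_one_le

theorem continuous_logEuler {σ : ℝ} (hσ : 0 < σ) (N : ℕ) :
    Continuous fun t : ℝ => logEuler N (σ + t * Complex.I) := by
  rw [continuous_iff_continuousAt]
  intro t
  have h := (differentiableAt_logEuler N (s := σ + t * Complex.I) (by simpa)).continuousAt
  exact ContinuousAt.comp (f := fun t : ℝ => (σ : ℂ) + t * Complex.I) h (by fun_prop)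

theorem cauchySeq_eulerChar {σ : ℝ} (hσ : 1 / 2 < σ) (w : ℂ) :
    CauchySeq fun N => eulerChar σ N w := by
  have hσ0 : 0 < σ := by linarith
  rw [Metric.cauchySeq_iff']
  intro ε hε
  set η := ε / (2 * (2 * ‖w‖ + 3)) with hη
  have hη0 : 0 < η := by positivity
  obtain ⟨N₀, hN₀⟩ := exists_exceptional_logEuler hσ hη0
  refine ⟨N₀, fun N hN => ?_⟩
  obtain ⟨T₁, -, h₁⟩ := hN₀ N hN
  obtain ⟨T₂, -, h₂⟩ := hN₀ N₀ le_rfl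
  have hc : ∀ N, Continuous fun t : ℝ => Complex.exp
      ((inner ℝ (logEuler N (σ + t * Complex.I)) w : ℝ) * Complex.I) := fun N =>
    continuous_exp_inner (continuous_logEuler hσ0 N) w
  have hlim := ((tendsto_meanVal_logEuler hσ0 N w).sub
    (tendsto_meanVal_logEuler hσ0 N₀ w)).norm
  have hle : ‖eulerChar σ N w - eulerChar σ N₀ w‖ ≤ η * (2 * ‖w‖ + 2) := by
    refine le_of_tendsto hlim ?_
    filter_upwards [eventually_ge_atTop T₁, eventually_ge_atTop T₂, eventually_gt_atTop 0]
      with T hT₁ hT₂ hT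
    rw [← meanVal_sub (hc N) (hc N₀)]
    obtain ⟨B₁, hB₁, hg₁⟩ := h₁ T hT₁
    obtain ⟨B₂, hB₂, hg₂⟩ := h₂ T hT₂
    have hB : volume (B₁ ∪ B₂) ≤ ENNReal.ofReal (2 * η * T) := by
      refine (measure_union_le _ _).trans ((add_le_add hB₁ hB₂).trans_eq ?_)
      rw [← ENNReal.ofReal_add (by positivity) (by positivity)]
      congr 1; ring
    refine (norm_meanVal_le_of_exceptional (δ := 2 * η * ‖w‖) (K := 2) hT (by positivity)
      (by positivity) (fun t => ?_) hB fun t ht htB => ?_).trans_eq (by ring)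
    · refine (norm_sub_le _ _).trans ?_
      linarith [norm_exp_ofReal_I_le (inner ℝ (logEuler N (σ + t * Complex.I)) w),
        norm_exp_ofReal_I_le (inner ℝ (logEuler N₀ (σ + t * Complex.I)) w)]
    · rw [Set.mem_union, not_or] at htB
      refine (norm_exp_I_sub_exp_I_le _ _).trans ?_
      rw [← inner_sub_left]
      refine (abs_real_inner_le_norm _ _).trans ?_
      gcongr
      have e : logEuler N (σ + t * Complex.I) - logEuler N₀ (σ + t * Complex.I)
          = (logZetaLine σ t - logEuler N₀ (σ + t * Complex.I))
            - (logZetaLine σ t - logEuler N (σ + t * Complex.I)) := by ring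
      rw [e]
      refine (norm_sub_le _ _).trans ?_
      linarith [(hg₁ t ht htB.1).2, (hg₂ t ht htB.2).2]
  rw [dist_eq_norm]
  refine hle.trans_lt ?_
  rw [hη, div_mul_eq_mul_div, div_lt_iff₀ (by positivity)]
  nlinarith [norm_nonneg w]

theorem continuous_circleChar {r : ℝ} (hr : 0 ≤ r) (hr1 : r < 1) : Continuous (circleChar r) := by
  refine continuous_of_dominated (bound := fun _ => 1) (fun w => ?_) (fun w => ?_)
    (integrable_const _) ?_
  · exact (continuous_exp_inner
      (continuous_neg_log_one_sub_mul_fourier hr hr1) w).aestronglyMeasurable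
  · exact ae_of_all _ fun x => norm_exp_ofReal_I_le _
  · exact ae_of_all _ fun x => ((Complex.continuous_ofReal.comp
      (continuous_const.inner continuous_id)).mul continuous_const).cexp

theorem continuous_eulerChar {σ : ℝ} (hσ : 0 < σ) (N : ℕ) : Continuous (eulerChar σ N) :=
  continuous_finsetProd _ fun p hp => continuous_circleChar (by positivity)
    (Real.rpow_lt_one_of_one_lt_of_neg
      (by exact_mod_cast (Nat.prime_of_mem_primeFactors hp).one_lt) (by linarith))

theorem exists_tendsto_eulerChar {σ : ℝ} (hσ : 1 / 2 < σ) : ∃ Φ : ℂ → ℂ,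
    (∀ w, Tendsto (fun N => eulerChar σ N w) atTop (nhds (Φ w))) ∧ Integrable Φ := by
  choose Φ hΦ using fun w => cauchySeq_tendsto_of_complete (cauchySeq_eulerChar hσ w)
  have hσ0 : 0 < σ := by linarith
  refine ⟨Φ, hΦ, ?_⟩
  obtain ⟨C, -, hCb⟩ := norm_eulerChar_le hσ0
  have hm : Measurable Φ := measurable_of_tendsto_metrizable
    (fun N => (continuous_eulerChar hσ0 N).measurable) (tendsto_pi_nhds.2 hΦ)
  refine Integrable.mono' (g := fun w => C * (1 + ‖w‖) ^ (-3 : ℝ)) ?_ hm.aestronglyMeasurable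
    (ae_of_all _ fun w => le_of_tendsto (hΦ w).norm (hCb w))
  refine (integrable_one_add_norm ?_).const_mul C
  rw [Complex.finrank_real_complex]
  norm_num

end

section

open scoped FourierTransform SchwartzMap

theorem meanVal_comp_eq_integral_fourier {φ : ℝ → ℂ} (hφ : Continuous φ) (g : 𝓢(ℂ, ℂ)) {T : ℝ}
    (hT : 0 < T) :
    meanVal T (fun t => g (φ t)) = ∫ v : ℂ, 𝓕 (g : ℂ → ℂ) v *
      meanVal T fun t => Complex.exp ((inner ℝ (φ t) ((2 * Real.pi) • v) : ℝ) * Complex.I) := by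
  have hF : Integrable (𝓕 (g : ℂ → ℂ)) := by
    rw [← SchwartzMap.fourier_coe]; exact (𝓕 g).integrable
  have h1 : ∀ t, g (φ t) = ∫ v : ℂ, 𝓕 (g : ℂ → ℂ) v *
      Complex.exp ((inner ℝ (φ t) ((2 * Real.pi) • v) : ℝ) * Complex.I) := by
    intro t
    conv_lhs => rw [← g.continuous.fourierInv_fourier_eq g.integrable hF]
    rw [Real.fourierInv_eq']
    refine integral_congr_ae (ae_of_all _ fun v => ?_)
    simp only [smul_eq_mul]
    rw [mul_comm, inner_smul_right, real_inner_comm]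
  simp only [meanVal]
  simp_rw [h1]
  rw [intervalIntegral.integral_of_le (by linarith), integral_integral_swap,
    ← integral_const_mul]
  · refine integral_congr_ae (ae_of_all _ fun v => ?_)
    simp only
    rw [integral_const_mul, intervalIntegral.integral_of_le (by linarith)]
    ring
  · have hc : Continuous fun p : ℝ × ℂ =>
        Complex.exp ((inner ℝ (φ p.1) ((2 * Real.pi) • p.2) : ℝ) * Complex.I) :=
      ((Complex.continuous_ofReal.comp ((hφ.comp continuous_fst).inner
        (continuous_snd.const_smul (2 * Real.pi)))).mul continuous_const).cexp
    have hI : Integrable (fun p : ℝ × ℂ => 𝓕 (g : ℂ → ℂ) p.2)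
        ((volume.restrict (Set.Ioc (-T) T)).prod volume) := hF.comp_snd _
    refine hI.mul_bdd (c := 1) hc.aestronglyMeasurable (ae_of_all _ fun p => ?_)
    exact norm_exp_ofReal_I_le _

theorem tendsto_meanVal_comp {φ : ℝ → ℂ} (hφ : Continuous φ) {χ : ℂ → ℂ}
    (hχ : ∀ w, Tendsto (fun T => meanVal T fun t =>
      Complex.exp ((inner ℝ (φ t) w : ℝ) * Complex.I)) atTop (nhds (χ w))) (g : 𝓢(ℂ, ℂ)) :
    Tendsto (fun T => meanVal T fun t => g (φ t)) atTop
      (nhds (∫ v : ℂ, 𝓕 (g : ℂ → ℂ) v * χ ((2 * Real.pi) • v))) := by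
  have hF : Integrable (𝓕 (g : ℂ → ℂ)) := by
    rw [← SchwartzMap.fourier_coe]; exact (𝓕 g).integrable
  have hlim : Tendsto (fun T => ∫ v : ℂ, 𝓕 (g : ℂ → ℂ) v *
      meanVal T fun t => Complex.exp ((inner ℝ (φ t) ((2 * Real.pi) • v) : ℝ) * Complex.I)) atTop
      (nhds (∫ v : ℂ, 𝓕 (g : ℂ → ℂ) v * χ ((2 * Real.pi) • v))) := by
    refine tendsto_integral_filter_of_dominated_convergence (fun v => ‖𝓕 (g : ℂ → ℂ) v‖) ?_ ?_
      hF.norm (ae_of_all _ fun v => (hχ _).const_mul _)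
    · refine Eventually.of_forall fun T => hF.aestronglyMeasurable.mul ?_
      refine Continuous.aestronglyMeasurable ?_
      refine continuous_const.mul
        (intervalIntegral.continuous_parametric_intervalIntegral_of_continuous' ?_ _ _)
      exact ((Complex.continuous_ofReal.comp ((hφ.comp continuous_snd).inner
        (continuous_fst.const_smul (2 * Real.pi)))).mul continuous_const).cexp
    · filter_upwards [eventually_gt_atTop 0] with T hT
      refine ae_of_all _ fun v => ?_
      rw [norm_mul]
      exact mul_le_of_le_one_right (norm_nonneg _)
        (norm_meanVal_le hT fun t => norm_exp_ofReal_I_le _)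
  refine hlim.congr' ?_
  filter_upwards [eventually_gt_atTop 0] with T hT
  exact (meanVal_comp_eq_integral_fourier hφ g hT).symm

theorem integral_fourier_mul_eq {g Ψ : ℂ → ℂ} (hg : Integrable g) (hΨ : Integrable Ψ) :
    ∫ v, 𝓕 g v * Ψ v = ∫ z, g z * 𝓕 Ψ z := by
  have := VectorFourier.integral_fourierIntegral_smul_eq_flip (L := innerₗ ℂ)
    Real.continuous_fourierChar continuous_inner hg hΨ
  rw [flip_innerₗ] at this
  exact this

/-- The mean values of test functions along the Euler polynomials converge to integrals against a
continuous bounded density. -/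
theorem exists_density_complex {σ : ℝ} (hσ : 1 / 2 < σ) : ∃ F : ℂ → ℂ, Continuous F ∧
    ∀ g : 𝓢(ℂ, ℂ), ∃ L : ℕ → ℂ,
      (∀ N, Tendsto (fun T => meanVal T fun t => g (logEuler N (σ + t * Complex.I))) atTop
        (nhds (L N))) ∧
      Tendsto L atTop (nhds (∫ z, g z * F z)) := by
  have hσ0 : 0 < σ := by linarith
  obtain ⟨Φ, hΦ, hΦi⟩ := exists_tendsto_eulerChar hσ
  have hΨ : Integrable fun v : ℂ => Φ ((2 * Real.pi) • v) :=
    hΦi.comp_smul (by positivity)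
  refine ⟨𝓕 fun v : ℂ => Φ ((2 * Real.pi) • v), ?_, fun g =>
    ⟨fun N => ∫ v : ℂ, 𝓕 (g : ℂ → ℂ) v * eulerChar σ N ((2 * Real.pi) • v), fun N => ?_, ?_⟩⟩
  · exact VectorFourier.fourierIntegral_continuous Real.continuous_fourierChar
      (by exact continuous_inner) hΨ
  · exact tendsto_meanVal_comp (continuous_logEuler hσ0 N)
      (fun w => tendsto_meanVal_logEuler hσ0 N w) g
  · have hF : Integrable (𝓕 (g : ℂ → ℂ)) := by
      rw [← SchwartzMap.fourier_coe]; exact (𝓕 g).integrable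
    rw [← integral_fourier_mul_eq g.integrable hΨ]
    refine tendsto_integral_of_dominated_convergence (fun v => ‖𝓕 (g : ℂ → ℂ) v‖) (fun N => ?_)
      hF.norm (fun N => ae_of_all _ fun v => ?_) (ae_of_all _ fun v => (hΦ _).const_mul _)
    · exact hF.aestronglyMeasurable.mul ((continuous_eulerChar hσ0 N).comp
        (continuous_id.const_smul (2 * Real.pi))).aestronglyMeasurable
    · rw [norm_mul]
      exact mul_le_of_le_one_right (norm_nonneg _) (norm_eulerChar_le_one σ N _)

end

section

open scoped ContDiff

theorem meanVal_ofReal (T : ℝ) (f : ℝ → ℝ) :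
    meanVal T (fun t => (f t : ℂ)) = (((∫ t in (-T)..T, f t) / (2 * T) : ℝ) : ℂ) := by
  rw [meanVal, intervalIntegral.integral_ofReal]
  push_cast
  ring

theorem exists_density_real {σ : ℝ} (hσ : 1 / 2 < σ) : ∃ F : ℂ → ℝ, Continuous F ∧
    (∀ z, 0 ≤ F z) ∧
    ∀ g : ℂ → ℝ, ContDiff ℝ ∞ g → HasCompactSupport g → ∃ L : ℕ → ℝ,
      (∀ N, Tendsto (fun T => (∫ t in (-T)..T, g (logEuler N (σ + t * Complex.I))) / (2 * T)) atTop
        (nhds (L N))) ∧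
      Tendsto L atTop (nhds (∫ z, g z * F z)) := by
  obtain ⟨F, hF, h⟩ := exists_density_complex hσ
  have key : ∀ g : ℂ → ℝ, ContDiff ℝ ∞ g → HasCompactSupport g → ∃ L : ℕ → ℝ,
      (∀ N, Tendsto (fun T => (∫ t in (-T)..T, g (logEuler N (σ + t * Complex.I))) / (2 * T)) atTop
        (nhds (L N))) ∧
      Tendsto L atTop (nhds (∫ z, g z * (F z).re)) := by
    intro g hg hgc
    have hgc' : HasCompactSupport fun z => (g z : ℂ) := hgc.comp_left Complex.ofReal_zero
    have hg' : ContDiff ℝ ∞ fun z => (g z : ℂ) := Complex.ofRealCLM.contDiff.comp hg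
    obtain ⟨L, hL, hL'⟩ := h (hgc'.toSchwartzMap hg')
    refine ⟨fun N => (L N).re, fun N => ?_, ?_⟩
    · have := (Complex.continuous_re.tendsto _).comp (hL N)
      refine this.congr fun T => ?_
      exact (congrArg Complex.re
        (meanVal_ofReal T fun t => g (logEuler N (σ + t * Complex.I)))).trans (Complex.ofReal_re _)
    · have hi : Integrable fun z => (g z : ℂ) * F z :=
        (hg'.continuous.mul hF).integrable_of_hasCompactSupport hgc'.mul_right
      have e : ∫ z, g z * (F z).re = (∫ z, (g z : ℂ) * F z).re := by
        refine Eq.trans ?_ (integral_re hi)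
        exact integral_congr_ae (ae_of_all _ fun z => (Complex.re_ofReal_mul _ _).symm)
      rw [e]
      exact (Complex.continuous_re.tendsto _).comp hL'
  refine ⟨fun z => (F z).re, Complex.continuous_re.comp hF, fun z₀ => ?_, key⟩
  by_contra! hz
  have hcF : Continuous fun z => (F z).re := Complex.continuous_re.comp hF
  obtain ⟨g, hgs, hgc, hg, hg01, hgz⟩ := exists_contDiff_tsupport_subset (n := ⊤)
    ((isOpen_lt hcF continuous_const).mem_nhds hz)
  obtain ⟨L, hL, hL'⟩ := key g hg hgc
  have hg0 : ∀ z, 0 ≤ g z := fun z => (hg01 ⟨z, rfl⟩).1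
  have hLn : ∀ N, 0 ≤ L N := fun N => by
    refine ge_of_tendsto (hL N) ?_
    filter_upwards [eventually_gt_atTop 0] with T hT
    exact div_nonneg (intervalIntegral.integral_nonneg (by linarith) fun t _ => hg0 _) (by linarith)
  have h1 : 0 ≤ ∫ z, g z * (F z).re := ge_of_tendsto' hL' hLn
  have hpos : 0 < ∫ z, -(g z * (F z).re) := by
    refine Continuous.integral_pos_of_hasCompactSupport_nonneg_nonzero (x := z₀)
      (hg.continuous.mul hcF).neg ?_ (fun z => ?_) ?_
    · exact (hgc.mul_right (f' := fun z => (F z).re)).neg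
    · by_cases hz' : z ∈ tsupport g
      · have : (F z).re < 0 := hgs hz'
        have := mul_nonneg (hg0 z) (neg_nonneg.2 this.le)
        simp only [Pi.zero_apply]; linarith
      · simp [image_eq_zero_of_notMem_tsupport hz']
    · simp [hgz, hz.ne]
  rw [integral_neg] at hpos
  linarith

end

section

open scoped ContDiff Manifold

theorem exists_smooth_bump {s t : Set ℂ} (hs : IsOpen s) (ht : IsClosed t) (h : t ⊆ s) :
    ∃ g : ℂ → ℝ, ContDiff ℝ ∞ g ∧ (∀ z, 0 ≤ g z) ∧ (∀ z, g z ≤ 1) ∧ Function.support g = s ∧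
      ∀ z ∈ t, g z = 1 := by
  obtain ⟨g, hg, hr, hsupp, h1⟩ :=
    exists_contMDiff_support_eq_eq_one_iff (n := ⊤) 𝓘(ℝ, ℂ) hs ht h
  exact ⟨g, hg.contDiff, fun z => (hr ⟨z, rfl⟩).1, fun z => (hr ⟨z, rfl⟩).2, hsupp,
    fun z hz => (h1 z).1 hz⟩

theorem toReal_withDensity_ofReal {F : ℂ → ℝ} (hF : Continuous F) (hF0 : ∀ z, 0 ≤ F z) {s : Set ℂ}
    (hs : MeasurableSet s) :
    ((volume.withDensity fun z => ENNReal.ofReal (F z)) s).toReal = ∫ z in s, F z := by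
  rw [withDensity_apply _ hs, integral_eq_lintegral_of_nonneg_ae (ae_of_all _ hF0)
    hF.aestronglyMeasurable]

theorem exists_smooth_majorant {F : ℂ → ℝ} (hF : Continuous F) (hF0 : ∀ z, 0 ≤ F z) {R : Set ℂ}
    (hR : IsCompact R) {ε : ℝ} (hε : 0 < ε) :
    ∃ g : ℂ → ℝ, ContDiff ℝ ∞ g ∧ HasCompactSupport g ∧ (∀ z, 0 ≤ g z) ∧
      (∃ δ > 0, ∀ z ∈ Metric.cthickening δ R, 1 ≤ g z) ∧
      ∫ z, g z * F z < (∫ z in R, F z) + ε := by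
  set ν : Measure ℂ := volume.withDensity fun z => ENNReal.ofReal (F z) with hν
  have : IsLocallyFiniteMeasure ν := IsLocallyFiniteMeasure.withDensity_ofReal hF
  obtain ⟨U, hRU, hU, hUν⟩ := R.exists_isOpen_lt_add (μ := ν) hR.measure_lt_top.ne
    (ENNReal.ofReal_pos.2 hε).ne'
  obtain ⟨r₁, hr₁, hr₁U⟩ := hR.exists_cthickening_subset_open hU hRU
  obtain ⟨r₂, hr₂, hr₂c⟩ := hR.exists_isCompact_cthickening
  set r := min r₁ r₂
  have hr : 0 < r := lt_min hr₁ hr₂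
  have hc : IsCompact (Metric.cthickening r R) :=
    hr₂c.of_isClosed_subset Metric.isClosed_cthickening
      (Metric.cthickening_mono (min_le_right _ _) _)
  obtain ⟨g, hg, hg0, hg1, hgs, hgt⟩ := exists_smooth_bump
    (Metric.isOpen_thickening (δ := r) (E := R))
    (Metric.isClosed_cthickening (δ := r / 2) (E := R))
    (Metric.cthickening_subset_thickening' hr (by linarith) _)
  have hz : ∀ z ∉ Metric.cthickening r R, g z = 0 := fun z hz => by
    rw [← Function.notMem_support, hgs]
    exact fun h => hz (Metric.thickening_subset_cthickening _ _ h)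
  refine ⟨g, hg, HasCompactSupport.intro hc fun {z} => hz z, hg0,
    ⟨r / 2, by positivity, fun z hz => (hgt z hz).ge⟩, ?_⟩
  rw [← setIntegral_eq_integral_of_forall_compl_eq_zero (s := Metric.cthickening r R)
    fun z h => by rw [hz z h, zero_mul]]
  refine lt_of_le_of_lt (setIntegral_mono_on
    ((hg.continuous.mul hF).continuousOn.integrableOn_compact hc)
    (hF.continuousOn.integrableOn_compact hc) hc.measurableSet
    fun z _ => mul_le_of_le_one_left (hF0 z) (hg1 z)) ?_
  rw [← toReal_withDensity_ofReal hF hF0 hc.measurableSet,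
    ← toReal_withDensity_ofReal hF hF0 hR.measurableSet, ← hν]
  have h1 : ν (Metric.cthickening r R) < ν R + ENNReal.ofReal ε :=
    (measure_mono ((Metric.cthickening_mono (min_le_left _ _) _).trans hr₁U)).trans_lt hUν
  have h2 := ENNReal.toReal_strict_mono
    (ENNReal.add_ne_top.2 ⟨hR.measure_lt_top.ne, ENNReal.ofReal_ne_top⟩) h1
  rwa [ENNReal.toReal_add hR.measure_lt_top.ne ENNReal.ofReal_ne_top,
    ENNReal.toReal_ofReal hε.le] at h2

theorem exists_smooth_minorant {F : ℂ → ℝ} (hF : Continuous F) (hF0 : ∀ z, 0 ≤ F z) {R : Set ℂ}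
    (hR : IsCompact R) (hfr : volume (frontier R) = 0) {ε : ℝ} (hε : 0 < ε) :
    ∃ g : ℂ → ℝ, ContDiff ℝ ∞ g ∧ HasCompactSupport g ∧ (∀ z, 0 ≤ g z) ∧ (∀ z, g z ≤ 1) ∧
      (∃ δ > 0, ∀ z, g z ≠ 0 → Metric.closedBall z δ ⊆ R) ∧
      (∫ z in R, F z) - ε < ∫ z, g z * F z := by
  set ν : Measure ℂ := volume.withDensity fun z => ENNReal.ofReal (F z) with hν
  have : IsLocallyFiniteMeasure ν := IsLocallyFiniteMeasure.withDensity_ofReal hF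
  have hνR : ν (interior R) = ν R := by
    refine measure_congr (interior_ae_eq_of_null_frontier ?_)
    exact withDensity_absolutelyContinuous _ _ hfr
  obtain ⟨K, hKR, hK, hKν⟩ : ∃ K ⊆ interior R, IsCompact K ∧
      (∫ z in R, F z) - ε < ∫ z in K, F z := by
    by_cases h0 : ν R = 0
    · refine ⟨∅, Set.empty_subset _, isCompact_empty, ?_⟩
      rw [← toReal_withDensity_ofReal hF hF0 hR.measurableSet, ← hν, h0]
      simpa
    · obtain ⟨K, hKR, hK, hKν⟩ := isOpen_interior.exists_lt_isCompact (μ := ν) (U := interior R)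
        (r := ν R - ENNReal.ofReal ε) (by
          rw [hνR]
          exact ENNReal.sub_lt_self hR.measure_lt_top.ne h0 (ENNReal.ofReal_pos.2 hε).ne')
      refine ⟨K, hKR, hK, ?_⟩
      rw [← toReal_withDensity_ofReal hF hF0 hR.measurableSet,
        ← toReal_withDensity_ofReal hF hF0 hK.measurableSet, ← hν]
      have h1 : ν R < ν K + ENNReal.ofReal ε := by
        by_contra! hle
        exact absurd hKν (not_lt.2 (ENNReal.le_sub_of_add_le_right ENNReal.ofReal_ne_top hle))
      have h2 := ENNReal.toReal_strict_mono
        (ENNReal.add_ne_top.2 ⟨hK.measure_lt_top.ne, ENNReal.ofReal_ne_top⟩) h1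
      rw [ENNReal.toReal_add hK.measure_lt_top.ne ENNReal.ofReal_ne_top,
        ENNReal.toReal_ofReal hε.le] at h2
      linarith
  obtain ⟨r, hr, hrR⟩ := hK.exists_cthickening_subset_open isOpen_interior hKR
  obtain ⟨g, hg, hg0, hg1, hgs, hgt⟩ := exists_smooth_bump
    (Metric.isOpen_thickening (δ := r / 2) (E := K)) hK.isClosed
    (Metric.self_subset_thickening (by positivity) _)
  have hball : ∀ z, g z ≠ 0 → Metric.closedBall z (r / 2) ⊆ R := fun z hz w hw => by
    have hz' : z ∈ Metric.thickening (r / 2) K := hgs ▸ Function.mem_support.2 hz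
    obtain ⟨k, hk, hzk⟩ := Metric.mem_thickening_iff.1 hz'
    refine interior_subset (hrR (Metric.mem_cthickening_of_dist_le w k r K hk ?_))
    linarith [dist_triangle w z k, Metric.mem_closedBall.1 hw]
  have hgR : ∀ z ∉ R, g z = 0 := fun z hz => by
    by_contra h
    exact hz (hball z h (Metric.mem_closedBall_self (by positivity)))
  have hgc : HasCompactSupport g := HasCompactSupport.intro hR fun {z} => hgR z
  refine ⟨g, hg, hgc, hg0, hg1, ⟨r / 2, by positivity, hball⟩, hKν.trans_le ?_⟩
  have hi : Integrable fun z => g z * F z :=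
    (hg.continuous.mul hF).integrable_of_hasCompactSupport hgc.mul_right
  calc ∫ z in K, F z = ∫ z in K, g z * F z :=
        setIntegral_congr_fun hK.measurableSet fun z hz => by simp [hgt z hz]
    _ ≤ ∫ z, g z * F z :=
        setIntegral_le_integral hi (ae_of_all _ fun z => mul_nonneg (hg0 z) (hF0 z))

theorem tendsto_volume_logZetaLine_mem {σ : ℝ} (hσ : 1 / 2 < σ) : ∃ F : ℂ → ℝ, Continuous F ∧
    (∀ z, 0 ≤ F z) ∧ ∀ R : Set ℂ, IsCompact R → volume (frontier R) = 0 →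
      Tendsto (fun T : ℝ => (volume {t : ℝ | t ∈ Set.Icc (-T) T ∧ t ∈ OmegaZeta σ ∧
        logZetaLine σ t ∈ R}).toReal / (2 * T)) atTop (nhds (∫ z in R, F z)) := by
  obtain ⟨F, hF, hF0, hlim⟩ := exists_density_real hσ
  have hσ0 : 0 < σ := by linarith
  refine ⟨F, hF, hF0, fun R hR hfr => ?_⟩
  have hfin : ∀ T : ℝ, volume {t : ℝ | t ∈ Set.Icc (-T) T ∧ t ∈ OmegaZeta σ ∧
      logZetaLine σ t ∈ R} ≠ ⊤ := fun T => ne_top_of_le_ne_top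
    (measure_Icc_lt_top (a := -T) (b := T)).ne (measure_mono fun t ht => ht.1)
  rw [Metric.tendsto_nhds]
  intro ε hε
  obtain ⟨g₁, hg₁, hg₁c, hg₁0, ⟨δ₁, hδ₁, hg₁R⟩, hg₁F⟩ :=
    exists_smooth_majorant hF hF0 hR (ε := ε / 4) (by positivity)
  obtain ⟨g₂, hg₂, hg₂c, hg₂0, hg₂1, ⟨δ₂, hδ₂, hg₂R⟩, hg₂F⟩ :=
    exists_smooth_minorant hF hF0 hR hfr (ε := ε / 4) (by positivity)
  obtain ⟨L₁, hL₁, hL₁'⟩ := hlim g₁ hg₁ hg₁c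
  obtain ⟨L₂, hL₂, hL₂'⟩ := hlim g₂ hg₂ hg₂c
  set η := min (ε / 2) (min δ₁ δ₂)
  have hη : 0 < η := by positivity
  obtain ⟨N₀, hN₀⟩ := exists_exceptional_logEuler hσ hη
  obtain ⟨N, hN, hN₁, hN₂⟩ := ((eventually_ge_atTop N₀).and
    ((hL₁'.eventually_lt_const (u := (∫ z in R, F z) + ε / 2) (by linarith)).and
    (hL₂'.eventually_const_lt (u := (∫ z in R, F z) - ε / 2) (by linarith)))).exists
  obtain ⟨T₀, -, hT₀⟩ := hN₀ N hN
  have hfN := continuous_logEuler hσ0 N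
  filter_upwards [eventually_ge_atTop T₀, eventually_gt_atTop 0,
    (hL₁ N).eventually_lt_const hN₁, (hL₂ N).eventually_const_lt hN₂] with T hT hT0 h₁ h₂
  obtain ⟨B, hB, hgood⟩ := hT₀ T hT
  set A := {t : ℝ | t ∈ Set.Icc (-T) T ∧ t ∈ OmegaZeta σ ∧ logZetaLine σ t ∈ R}
  have hBη : volume.real B ≤ η * T := ENNReal.toReal_le_of_le_ofReal (by positivity) hB
  have hBfin : volume B ≠ ⊤ := ne_top_of_le_ne_top ENNReal.ofReal_ne_top hB
  have hηε : η ≤ ε / 2 := min_le_left _ _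
  have upper : volume.real A ≤ η * T + ∫ t in (-T)..T, g₁ (logEuler N (σ + t * Complex.I)) := by
    have hsub : A ⊆ B ∪ {t | 1 ≤ g₁ (logEuler N (σ + t * Complex.I))} ∩ Set.Icc (-T) T := by
      rintro t ⟨ht, -, htR⟩
      by_cases htB : t ∈ B
      · exact Or.inl htB
      · refine Or.inr ⟨hg₁R _ (Metric.mem_cthickening_of_dist_le _ _ _ _ htR ?_), ht⟩
        rw [dist_comm, dist_eq_norm]
        exact (hgood t ht htB).2.trans ((min_le_right _ _).trans (min_le_left _ _))
    refine (measureReal_mono hsub ?_).trans ((measureReal_union_le _ _).trans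
      (add_le_add hBη ?_))
    · exact measure_union_ne_top hBfin
        (ne_top_of_le_ne_top measure_Icc_lt_top.ne (measure_mono Set.inter_subset_right))
    · rw [intervalIntegral.integral_of_le (by linarith), ← integral_Icc_eq_integral_Ioc]
      have := mul_meas_ge_le_integral_of_nonneg (μ := volume.restrict (Set.Icc (-T) T))
        (ae_of_all _ fun t : ℝ => hg₁0 (logEuler N (σ + t * Complex.I)))
        (hg₁.continuous.comp hfN).continuousOn.integrableOn_Icc 1
      have hm : MeasurableSet {t : ℝ | 1 ≤ g₁ (logEuler N (σ + t * Complex.I))} :=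
        measurableSet_le measurable_const (hg₁.continuous.comp hfN).measurable
      rwa [one_mul, measureReal_restrict_apply hm] at this
  have lower : ∫ t in (-T)..T, g₂ (logEuler N (σ + t * Complex.I)) ≤ volume.real A + η * T := by
    set S := {t : ℝ | g₂ (logEuler N (σ + t * Complex.I)) ≠ 0} ∩ Set.Icc (-T) T
    have hS : MeasurableSet S :=
      (isOpen_ne_fun (hg₂.continuous.comp hfN) continuous_const).measurableSet.inter
        measurableSet_Icc
    have hSfin : volume S ≠ ⊤ :=
      ne_top_of_le_ne_top measure_Icc_lt_top.ne (measure_mono Set.inter_subset_right)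
    have hsub : S ⊆ A ∪ B := by
      rintro t ⟨hg, ht⟩
      by_cases htB : t ∈ B
      · exact Or.inr htB
      · refine Or.inl ⟨ht, (hgood t ht htB).1, hg₂R _ hg ?_⟩
        rw [Metric.mem_closedBall, dist_eq_norm]
        exact (hgood t ht htB).2.trans ((min_le_right _ _).trans (min_le_right _ _))
    have h1 : ∫ t in (-T)..T, g₂ (logEuler N (σ + t * Complex.I)) ≤ volume.real S := by
      rw [intervalIntegral.integral_of_le (by linarith), ← integral_Icc_eq_integral_Ioc]
      have hind : ∫ t in Set.Icc (-T) T, S.indicator (fun _ => (1 : ℝ)) t = volume.real S := by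
        rw [integral_indicator hS, Measure.restrict_restrict hS,
          Set.inter_eq_left.2 Set.inter_subset_right, setIntegral_const, smul_eq_mul, mul_one]
      rw [← hind]
      refine setIntegral_mono_on (hg₂.continuous.comp hfN).continuousOn.integrableOn_Icc
        ((integrable_indicator_iff hS).2 (integrableOn_const hSfin)).integrableOn
        measurableSet_Icc fun t ht => ?_
      by_cases htS : t ∈ S
      · rw [Set.indicator_of_mem htS]
        exact hg₂1 _
      · rw [Set.indicator_of_notMem htS]
        exact (not_not.1 fun h => htS ⟨h, ht⟩).le
    exact h1.trans ((measureReal_mono hsub (measure_union_ne_top (hfin T) hBfin)).trans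
      ((measureReal_union_le _ _).trans (by gcongr)))
  change dist (volume.real A / (2 * T)) _ < ε
  rw [div_lt_iff₀ (by positivity)] at h₁
  rw [lt_div_iff₀ (by positivity)] at h₂
  rw [Real.dist_eq, abs_sub_lt_iff, sub_lt_iff_lt_add, sub_lt_comm, div_lt_iff₀ (by positivity),
    lt_div_iff₀ (by positivity)]
  have hηT : η * T ≤ ε / 2 * T := by gcongr
  constructor <;> nlinarith [mul_pos hε hT0]

end

end BohrJessen

/-- (Bohr–Jessen.) For `σ > 1/2` there is a continuous non-negative `F : ℂ → ℝ`
such that for every rectangle `R = [x₁,x₂] × [y₁,y₂]`,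
`lim_{T→∞} (1/(2T)) μ₁{t ∈ [−T,T] : t ∈ Ω_σ, log ζ(σ+it) ∈ R}` exists and equals
`∫_R F(x+iy) dx dy / (2π)`. -/
theorem bohr_jessen (σ : ℝ) (hσ : 1 / 2 < σ) :
    ∃ F : ℂ → ℝ, Continuous F ∧ (∀ z, 0 ≤ F z) ∧
      ∀ x₁ x₂ y₁ y₂ : ℝ, x₁ ≤ x₂ → y₁ ≤ y₂ →
        Tendsto
          (fun T : ℝ =>
            (volume {t : ℝ | t ∈ Set.Icc (-T) T ∧ t ∈ OmegaZeta σ ∧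
                  logZetaLine σ t ∈
                    {z : ℂ | x₁ ≤ z.re ∧ z.re ≤ x₂ ∧ y₁ ≤ z.im ∧ z.im ≤ y₂}}).toReal
              / (2 * T))
          atTop
          (nhds
            ((∫ z in {z : ℂ | x₁ ≤ z.re ∧ z.re ≤ x₂ ∧ y₁ ≤ z.im ∧ z.im ≤ y₂}, F z) /
              (2 * Real.pi))) := by
  obtain ⟨F, hF, hF0, hlim⟩ := BohrJessen.tendsto_volume_logZetaLine_mem hσ
  refine ⟨fun z => 2 * Real.pi * F z, continuous_const.mul hF,
    fun z => mul_nonneg (by positivity) (hF0 z), fun x₁ x₂ y₁ y₂ _ _ => ?_⟩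
  have hR : {z : ℂ | x₁ ≤ z.re ∧ z.re ≤ x₂ ∧ y₁ ≤ z.im ∧ z.im ≤ y₂} =
      Set.Icc x₁ x₂ ×ℂ Set.Icc y₁ y₂ := by
    ext z
    simp [Complex.mem_reProdIm, and_assoc]
  rw [integral_const_mul, mul_div_cancel_left₀ _ (by positivity), hR]
  refine hlim _ (isCompact_Icc.reProdIm isCompact_Icc) (Convex.addHaar_frontier _ ?_)
  exact ((convex_Icc x₁ x₂).linear_preimage Complex.reLm).inter
    ((convex_Icc y₁ y₂).linear_preimage Complex.imLm)
end
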